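/- arXiv:0910.4515 — 2 statements merged into one kernel-verified Lean document; each statement's English description precedes it below -/
import Mathlib

section
/- Let λ be a partition of n into at most p parts, let t', t'' ∈ SSYT(λ,p), and set D' := D(t', t_λ) and D'' := D(t'', t_λ) (identifying tableaux with words in [p]^n). Then (∏_{i>j} D'_{i,j}! · D''_{i,j}!) · Σ_{D ∈ P(n,p)} x^D ⟨A_D e_{t'}, e_{t''}⟩ = (∏_{j=1}^{p−1} ∏_{i=j+1}^{p} (d_{i→j})^{D''_{i,j}} (d*_{j→i})^{D'_{i,j}}) applied to P_λ, where d_{i→j} := Σ_{s=1}^{p} x_{i,s} ∂/∂x_{j,s} and d*_{i→j} := Σ_{s=1}^{p} x_{s,j} ∂/∂x_{s,i}. -/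
open scoped Classical
open Matrix

noncomputable section

/-- `D(a,b) ∈ ℕ^{p×p}`: `D(a,b)_{i,j}` counts positions `k` with `a_k = i` and `b_k = j`. -/
def Dmat {n p : ℕ} (a b : Fin n → Fin p) : Matrix (Fin p) (Fin p) ℕ :=
  Matrix.of fun i j => (Finset.univ.filter fun k => a k = i ∧ b k = j).card

/-- The 0/1 matrix `A_D` with `(A_D)_{a,b} = 1` iff `D(a,b) = D`. -/
def AD (n p : ℕ) (D : Matrix (Fin p) (Fin p) ℕ) :
    Matrix (Fin n → Fin p) (Fin n → Fin p) ℂ :=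
  Matrix.of fun a b => if Dmat a b = D then 1 else 0

/-- Row (0-indexed) of the `k`-th box (0-indexed, row-major numbering) of the Ferrers
diagram of `lam`: the number of indices `i` with `λ_0 + ⋯ + λ_i ≤ k`. -/
def rowOf (p : ℕ) (lam : Fin p → ℕ) (k : ℕ) : ℕ :=
  (Finset.univ.filter fun i : Fin p => (∑ j ∈ Finset.univ.filter (· ≤ i), lam j) ≤ k).card

/-- Column (0-indexed) of the `k`-th box of the Ferrers diagram of `lam`. -/
def colOf (p : ℕ) (lam : Fin p → ℕ) (k : ℕ) : ℕ :=
  k - ∑ j ∈ Finset.univ.filter (fun j : Fin p => (j : ℕ) < rowOf p lam k), lam j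

/-- The column group `C_λ`: permutations of the boxes mapping every box to a box
in the same column. -/
def colGroup (n p : ℕ) (lam : Fin p → ℕ) : Finset (Equiv.Perm (Fin n)) :=
  Finset.univ.filter fun σ => ∀ k : Fin n, colOf p lam (σ k : ℕ) = colOf p lam (k : ℕ)

/-- The row group `R_λ`: permutations of the boxes mapping every box to a box
in the same row. -/
def rowGroup (n p : ℕ) (lam : Fin p → ℕ) : Finset (Equiv.Perm (Fin n)) :=
  Finset.univ.filter fun σ => ∀ k : Fin n, rowOf p lam (σ k : ℕ) = rowOf p lam (k : ℕ)

/-- The vector `e_t = Σ_{σ ∈ C_λ} sgn(σ) Σ_{t' ∼ t} χ^{σ t'} ∈ ℂ^{[p]^n}`, where `t' ∼ t`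
means `t' = π t` for some `π ∈ R_λ`, and `(σ t)(k) = t(σ⁻¹ k)`. -/
noncomputable def eT (n p : ℕ) (lam : Fin p → ℕ) (t : Fin n → Fin p) :
    (Fin n → Fin p) → ℂ :=
  ∑ σ ∈ colGroup n p lam, ((Equiv.Perm.sign σ : ℤ) : ℂ) •
    ∑ t' ∈ Finset.univ.filter (fun t' : Fin n → Fin p =>
        ∃ π ∈ rowGroup n p lam, t' = fun k => t (π⁻¹ k)),
      (Pi.single (fun k => t' (σ⁻¹ k)) (1 : ℂ) : (Fin n → Fin p) → ℂ)

/-- The tableau `t_λ` whose entries in row `i` all equal `i`. -/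
def tLam (n p : ℕ) (hp : 0 < p) (lam : Fin p → ℕ) : Fin n → Fin p :=
  fun k => ⟨rowOf p lam (k : ℕ) % p, Nat.mod_lt _ hp⟩

/-- The vector `e_λ := e_{t_λ}`. -/
noncomputable def eLam (n p : ℕ) (hp : 0 < p) (lam : Fin p → ℕ) : (Fin n → Fin p) → ℂ :=
  eT n p lam (tLam n p hp lam)

/-- The polynomial `Q_k = k! · det((x_{i,j})_{1 ≤ i,j ≤ k})` in the variables
`x_{i,j}`, `i,j ∈ [p]` (for `k ≤ p`; `Q_0 = 1`). -/
noncomputable def Qpoly (p k : ℕ) : MvPolynomial (Fin p × Fin p) ℂ :=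
  (k.factorial : MvPolynomial (Fin p × Fin p) ℂ) *
    Matrix.det (Matrix.of fun i j : Fin k =>
      if h : (i : ℕ) < p ∧ (j : ℕ) < p then MvPolynomial.X (⟨i, h.1⟩, ⟨j, h.2⟩) else 0)

/-- The conjugate (dual) partition: `λ*_j = |{i : λ_i ≥ j}|`. -/
def conjPart (p : ℕ) (lam : Fin p → ℕ) (j : ℕ) : ℕ :=
  (Finset.univ.filter fun i : Fin p => j ≤ lam i).card

/-- The polynomial `P_λ = ∏_{j=1}^n Q_{λ*_j}`. -/
noncomputable def Ppoly (n p : ℕ) (lam : Fin p → ℕ) : MvPolynomial (Fin p × Fin p) ℂ :=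
  ∏ j ∈ Finset.range n, Qpoly p (conjPart p lam (j + 1))

/-- The exponent (as a finitely supported function on `Fin p × Fin p`) of the monomial
`x^D` attached to `D ∈ ℕ^{p×p}`. -/
noncomputable def expOf (p : ℕ) (D : Matrix (Fin p) (Fin p) ℕ) : (Fin p × Fin p) →₀ ℕ :=
  Finsupp.equivFunOnFinite.symm fun ij : Fin p × Fin p => D ij.1 ij.2

/-- The polynomial `f_A = Σ_{D ∈ P(n,p)} x^D ⟨A_D, A⟩`, where `⟨M,N⟩ = trace(N^*M)`
(matrices `D ∈ P(n,p)` are encoded with entries in `Fin (n+1)`). -/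
noncomputable def fPoly (n p : ℕ) (A : Matrix (Fin n → Fin p) (Fin n → Fin p) ℂ) :
    MvPolynomial (Fin p × Fin p) ℂ :=
  ∑ D ∈ (Finset.univ : Finset (Fin p → Fin p → Fin (n + 1))).filter
      (fun D => ∑ i, ∑ j, (D i j : ℕ) = n),
    MvPolynomial.monomial (expOf p (Matrix.of fun i j => (D i j : ℕ)))
      (Matrix.trace (Aᴴ * AD n p (Matrix.of fun i j => (D i j : ℕ))))

/-- The differential operator `d_{i→j} = Σ_s x_{i,s} ∂/∂x_{j,s}`. -/
noncomputable def dOp (p : ℕ) (i j : Fin p) :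
    MvPolynomial (Fin p × Fin p) ℂ → MvPolynomial (Fin p × Fin p) ℂ :=
  fun g => ∑ s : Fin p, MvPolynomial.X (i, s) * MvPolynomial.pderiv (j, s) g

/-- The differential operator `d*_{i→j} = Σ_s x_{s,j} ∂/∂x_{s,i}`. -/
noncomputable def dStarOp (p : ℕ) (i j : Fin p) :
    MvPolynomial (Fin p × Fin p) ℂ → MvPolynomial (Fin p × Fin p) ℂ :=
  fun g => ∑ s : Fin p, MvPolynomial.X (s, j) * MvPolynomial.pderiv (s, i) g

/-- A tableau (word) of shape `λ` is semistandard: entries weakly increase along each row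
and strictly increase down each column. -/
def IsSemistandard (n p : ℕ) (lam : Fin p → ℕ) (t : Fin n → Fin p) : Prop :=
  (∀ k k' : Fin n, rowOf p lam (k : ℕ) = rowOf p lam (k' : ℕ) → (k : ℕ) ≤ (k' : ℕ) →
    t k ≤ t k') ∧
  (∀ k k' : Fin n, colOf p lam (k : ℕ) = colOf p lam (k' : ℕ) →
    rowOf p lam (k : ℕ) < rowOf p lam (k' : ℕ) → t k < t k')

/-- The standard inner product `⟨x,y⟩ = Σ_a x_a conj(y_a)` on `ℂ^{[p]^n}`. -/
noncomputable def sinner {n p : ℕ} (x y : (Fin n → Fin p) → ℂ) : ℂ :=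
  ∑ a, x a * (starRingEnd ℂ) (y a)

/-- The operator `∏_{j=1}^{p-1} ∏_{i=j+1}^{p} (d_{i→j})^{D''_{i,j}} (d*_{j→i})^{D'_{i,j}}`,
the (noncommutative) product of operators taken with the pairs `(j,i)` left to right in
lexicographic order. -/
noncomputable def opProd (p : ℕ) (D' D'' : Matrix (Fin p) (Fin p) ℕ) :
    MvPolynomial (Fin p × Fin p) ℂ → MvPolynomial (Fin p × Fin p) ℂ :=
  ((List.finRange p).map fun j =>
    ((((List.finRange p).filter fun i => decide (j < i)).map fun i =>
      (dOp p i j)^[D'' i j] ∘ (dStarOp p j i)^[D' i j]).foldr (· ∘ ·) id)).foldr (· ∘ ·) id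


section Tableau

variable {n p : ℕ}

lemma mem_iff_lt_card_of_lower (P : Fin p → Prop) [DecidablePred P] (hP : ∀ i j, i ≤ j → P j → P i) (i : Fin p) :
    P i ↔ (i : ℕ) < (Finset.univ.filter P).card := by
  constructor
  · intro h
    have : Finset.Iic i ⊆ Finset.univ.filter P := by
      intro x hx
      simpa using hP x i (Finset.mem_Iic.mp hx) h
    have := Finset.card_le_card this
    rw [Fin.card_Iic] at this
    omega
  · intro h
    by_contra hi
    have : Finset.univ.filter P ⊆ Finset.Iio i := by
      intro x hx
      rw [Finset.mem_Iio]
      by_contra hx'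
      exact hi (hP i x (not_lt.mp hx') (by simpa using hx))
    have := Finset.card_le_card this
    rw [Fin.card_Iio] at this
    omega

/-- The number of boxes strictly above row `r`. -/
def rowStart (lam : Fin p → ℕ) (r : ℕ) : ℕ :=
  ∑ j ∈ Finset.univ.filter (fun j : Fin p => (j : ℕ) < r), lam j

lemma rowStart_succ (lam : Fin p → ℕ) (r : Fin p) :
    rowStart lam (r + 1) = rowStart lam r + lam r := by
  unfold rowStart
  have : (Finset.univ.filter fun j : Fin p => (j : ℕ) < r + 1) =
      insert r (Finset.univ.filter fun j : Fin p => (j : ℕ) < r) := by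
    ext j
    simp only [Finset.mem_filter, Finset.mem_univ, true_and, Finset.mem_insert, Fin.ext_iff]
    omega
  rw [this, Finset.sum_insert (by simp), add_comm]

lemma rowStart_mono (lam : Fin p → ℕ) {r s : ℕ} (h : r ≤ s) :
    rowStart lam r ≤ rowStart lam s := by
  unfold rowStart
  apply Finset.sum_le_sum_of_subset
  intro j
  simp only [Finset.mem_filter, Finset.mem_univ, true_and]
  omega

lemma rowStart_top (lam : Fin p → ℕ) : rowStart lam p = ∑ i, lam i := by
  simp [rowStart]

lemma rowStart_succ_le_iff (lam : Fin p → ℕ) (k : ℕ) (i : Fin p) :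
    rowStart lam (i + 1) ≤ k ↔ (i : ℕ) < rowOf p lam k := by
  have hS : ∀ i : Fin p, (∑ j ∈ Finset.univ.filter (· ≤ i), lam j) = rowStart lam (i + 1) := by
    intro i
    unfold rowStart
    congr 1
    ext j
    simp only [Finset.mem_filter, Finset.mem_univ, true_and, Fin.le_def]
    omega
  unfold rowOf
  simp_rw [hS]
  rw [← mem_iff_lt_card_of_lower (fun i : Fin p => rowStart lam (i + 1) ≤ k)]
  intro a b hab hb
  exact (rowStart_mono lam (by have := Fin.le_def.mp hab; omega)).trans hb

lemma rowOf_lt (lam : Fin p → ℕ) (hp : 0 < p) (hsum : ∑ i, lam i = n) (k : Fin n) :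
    rowOf p lam k < p := by
  by_contra h
  have h1 := (rowStart_succ_le_iff lam k ⟨p - 1, by omega⟩).mpr (by simp only; omega)
  simp only [Nat.sub_add_cancel hp, rowStart_top, hsum] at h1
  omega

lemma rowStart_rowOf_le (lam : Fin p → ℕ) (k : ℕ) : rowStart lam (rowOf p lam k) ≤ k := by
  rcases Nat.eq_zero_or_pos (rowOf p lam k) with h | h
  · rw [h]; simp [rowStart]
  · have hle : rowOf p lam k ≤ p := by
      unfold rowOf
      exact (Finset.card_le_univ _).trans (by simp)
    have h1 := (rowStart_succ_le_iff lam k ⟨rowOf p lam k - 1, by omega⟩).mpr (by simp only; omega)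
    simpa only [Nat.sub_add_cancel h] using h1

lemma rowStart_add_colOf (lam : Fin p → ℕ) (k : ℕ) :
    rowStart lam (rowOf p lam k) + colOf p lam k = k := by
  have := rowStart_rowOf_le lam k
  unfold colOf
  unfold rowStart at *
  omega

lemma colOf_lt (lam : Fin p → ℕ) (k : ℕ) (hr : rowOf p lam k < p) :
    colOf p lam k < lam ⟨rowOf p lam k, hr⟩ := by
  have h1 := (rowStart_succ_le_iff lam k ⟨rowOf p lam k, hr⟩).not.mpr (by simp)
  have h2 := rowStart_add_colOf lam k
  rw [rowStart_succ] at h1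
  simp only at h1
  omega

lemma exists_box (lam : Fin p → ℕ) (hsum : ∑ i, lam i = n) (r : Fin p) (c : ℕ)
    (hc : c < lam r) : ∃ k : Fin n, rowOf p lam k = r ∧ colOf p lam k = c := by
  have h1 := rowStart_succ lam r
  have h2 : rowStart lam (r + 1) ≤ n := by
    rw [← hsum, ← rowStart_top]
    exact rowStart_mono lam (by omega)
  have h3 : rowOf p lam (rowStart lam r + c) = r := by
    have h4 := (rowStart_succ_le_iff lam (rowStart lam r + c) r).not.mp (by omega)
    rcases Nat.eq_zero_or_pos (r : ℕ) with h | h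
    · omega
    · have h5 := (rowStart_succ_le_iff lam (rowStart lam r + c) ⟨r - 1, by omega⟩).mp
        (by simp only [Nat.sub_add_cancel h]; omega)
      simp only at h5
      omega
  refine ⟨⟨rowStart lam r + c, by omega⟩, h3, ?_⟩
  have h6 := rowStart_add_colOf lam (rowStart lam r + c)
  rw [h3] at h6
  simp only
  omega

lemma box_ext (lam : Fin p → ℕ) {k l : Fin n} (hr : rowOf p lam k = rowOf p lam l)
    (hc : colOf p lam k = colOf p lam l) : k = l := by
  apply Fin.ext
  rw [← rowStart_add_colOf lam k, ← rowStart_add_colOf lam l, hr, hc]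

lemma tLam_val (hp : 0 < p) (lam : Fin p → ℕ) (hsum : ∑ i, lam i = n) (k : Fin n) :
    (tLam n p hp lam k : ℕ) = rowOf p lam k :=
  Nat.mod_eq_of_lt (rowOf_lt lam hp hsum k)

lemma IsSemistandard.rowOf_le (hp : 0 < p) (lam : Fin p → ℕ)
    (hdec : ∀ i j : Fin p, i ≤ j → lam j ≤ lam i) (hsum : ∑ i, lam i = n)
    {t : Fin n → Fin p} (ht : IsSemistandard n p lam t) (k : Fin n) :
    rowOf p lam k ≤ t k := by
  induction h : rowOf p lam k generalizing k with
  | zero => omega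
  | succ r ih =>
    have hr := rowOf_lt lam hp hsum k
    have hc := colOf_lt lam k hr
    have hle := hdec ⟨r, by omega⟩ ⟨rowOf p lam k, hr⟩ (by rw [Fin.le_def]; simp only; omega)
    obtain ⟨l, hl, hl'⟩ := exists_box lam hsum ⟨r, by omega⟩ (colOf p lam k) (by omega)
    have h1 := ih l hl
    have h2 : t l < t k := ht.2 l k hl' (by simp only [hl]; omega)
    have := Fin.lt_def.mp h2
    omega

lemma IsSemistandard.Dmat_eq_zero (hp : 0 < p) (lam : Fin p → ℕ)
    (hdec : ∀ i j : Fin p, i ≤ j → lam j ≤ lam i) (hsum : ∑ i, lam i = n)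
    {t : Fin n → Fin p} (ht : IsSemistandard n p lam t) {i j : Fin p} (hij : i < j) :
    Dmat t (tLam n p hp lam) i j = 0 := by
  simp only [Dmat, Matrix.of_apply, Finset.card_eq_zero, Finset.filter_eq_empty_iff,
    Finset.mem_univ, true_implies]
  rintro k ⟨rfl, hk⟩
  have h1 := ht.rowOf_le hp lam hdec hsum k
  rw [← tLam_val hp lam hsum k, hk] at h1
  have := Fin.lt_def.mp hij
  omega

/-- The words `a` with prescribed off-diagonal counts `D(a,b)_{i,r} = c i r`, `i ≠ r`. -/
def offDiagClass (b : Fin n → Fin p) (c : Matrix (Fin p) (Fin p) ℕ) : Finset (Fin n → Fin p) :=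
  Finset.univ.filter fun a => ∀ i r, i ≠ r → Dmat a b i r = c i r

lemma mem_offDiagClass {b : Fin n → Fin p} {c : Matrix (Fin p) (Fin p) ℕ} {a : Fin n → Fin p} :
    a ∈ offDiagClass b c ↔ ∀ i r, i ≠ r → Dmat a b i r = c i r := by
  simp [offDiagClass]

lemma sum_Dmat (a b : Fin n → Fin p) (r : Fin p) :
    ∑ i, Dmat a b i r = (Finset.univ.filter fun k => b k = r).card := by
  rw [Finset.card_eq_sum_card_fiberwise (f := a) (t := Finset.univ) (by simp)]
  refine Finset.sum_congr rfl fun i _ => ?_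
  simp only [Dmat, Matrix.of_apply, Finset.filter_filter]
  congr 1
  ext k
  simp [and_comm]

lemma Dmat_eq_of_offDiag {a a' b : Fin n → Fin p}
    (h : ∀ i r, i ≠ r → Dmat a b i r = Dmat a' b i r) : Dmat a b = Dmat a' b := by
  ext i r
  by_cases hir : i = r
  · subst hir
    have h1 := (sum_Dmat a b i).trans (sum_Dmat a' b i).symm
    rw [← Finset.add_sum_erase _ _ (Finset.mem_univ i),
      ← Finset.add_sum_erase _ (fun j => Dmat a' b j i) (Finset.mem_univ i),
      Finset.sum_congr rfl fun j hj => h j i (Finset.ne_of_mem_erase hj)] at h1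
    exact Nat.add_right_cancel h1
  · exact h i r hir

lemma Dmat_eq_iff_exists_perm (a a' b : Fin n → Fin p) :
    Dmat a b = Dmat a' b ↔
      ∃ π : Equiv.Perm (Fin n), (∀ k, b (π k) = b k) ∧ a = fun k => a' (π⁻¹ k) := by
  constructor
  · intro h
    have hcard : ∀ x : Fin p × Fin p,
        Fintype.card {k // (a' k, b k) = x} = Fintype.card {k // (a k, b k) = x} := by
      rintro ⟨i, r⟩
      have h1 := congrFun (congrFun h i) r
      simp only [Dmat, Matrix.of_apply] at h1
      simp only [Prod.mk.injEq, Fintype.card_subtype]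
      exact h1.symm
    have e : ∀ x : Fin p × Fin p, {k // (a' k, b k) = x} ≃ {k // (a k, b k) = x} :=
      fun x => Fintype.equivOfCardEq (hcard x)
    have he := Equiv.ofFiberEquiv_map e
    simp only [Prod.mk.injEq] at he
    refine ⟨Equiv.ofFiberEquiv e, fun k => (he k).2, ?_⟩
    funext k
    have := (he ((Equiv.ofFiberEquiv e)⁻¹ k)).1
    rw [← Equiv.Perm.mul_apply, mul_inv_cancel, Equiv.Perm.one_apply] at this
    exact this
  · rintro ⟨π, hπ, rfl⟩
    ext i r
    simp only [Dmat, Matrix.of_apply]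
    symm
    refine Finset.card_equiv π fun k => ?_
    simp [hπ]

lemma rowEquivalent_eq_offDiagClass (hp : 0 < p) (lam : Fin p → ℕ) (hsum : ∑ i, lam i = n)
    (t : Fin n → Fin p) :
    (Finset.univ.filter fun t' : Fin n → Fin p =>
        ∃ π ∈ rowGroup n p lam, t' = fun k => t (π⁻¹ k)) =
      offDiagClass (tLam n p hp lam) (Dmat t (tLam n p hp lam)) := by
  ext a
  rw [mem_offDiagClass]
  have : (∀ i r, i ≠ r → Dmat a (tLam n p hp lam) i r = Dmat t (tLam n p hp lam) i r) ↔
      Dmat a (tLam n p hp lam) = Dmat t (tLam n p hp lam) :=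
    ⟨Dmat_eq_of_offDiag, fun h i r _ => by rw [h]⟩
  rw [this, Dmat_eq_iff_exists_perm]
  simp only [Finset.mem_filter, Finset.mem_univ, true_and, rowGroup, Fin.ext_iff,
    tLam_val hp lam hsum]

lemma offDiagClass_zero (b : Fin n → Fin p) : offDiagClass b 0 = {b} := by
  ext a
  simp only [mem_offDiagClass, Finset.mem_singleton, Dmat, Matrix.of_apply, Matrix.zero_apply,
    Finset.card_eq_zero, Finset.filter_eq_empty_iff, Finset.mem_univ, true_implies]
  constructor
  · intro h
    funext k
    by_contra hk
    exact h _ _ hk (x := k) ⟨rfl, rfl⟩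
  · rintro rfl i r hir k ⟨h1, h2⟩
    exact hir (h1.symm.trans h2)

lemma Dmat_update (a b : Fin n → Fin p) (k : Fin n) (x i r : Fin p) :
    Dmat (Function.update a k x) b i r + (if a k = i ∧ b k = r then 1 else 0) =
      Dmat a b i r + (if x = i ∧ b k = r then 1 else 0) := by
  simp only [Dmat, Matrix.of_apply, Finset.card_filter]
  rw [← Finset.add_sum_erase _ _ (Finset.mem_univ k),
    ← Finset.add_sum_erase _ (fun l => if a l = i ∧ b l = r then 1 else 0) (Finset.mem_univ k)]
  rw [Finset.sum_congr rfl (g := fun l => if a l = i ∧ b l = r then 1 else 0)]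
  · simp only [Function.update_self]
    omega
  · intro l hl
    rw [Function.update_of_ne (Finset.ne_of_mem_erase hl)]

/-- Raising the `(i, j)` entry of a matrix of counts by `m`. -/
def addEntry (c : Matrix (Fin p) (Fin p) ℕ) (i j : Fin p) (m : ℕ) : Matrix (Fin p) (Fin p) ℕ :=
  Matrix.of fun i' r => c i' r + if i' = i ∧ r = j then m else 0

lemma sum_offDiagClass_update {M : Type*} [AddCommMonoid M] (G : (Fin n → Fin p) → M)
    (b : Fin n → Fin p) (c : Matrix (Fin p) (Fin p) ℕ) {i j : Fin p} (hij : i ≠ j)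
    (hc : ∀ r, r ≠ j → c j r = 0) :
    ∑ a ∈ offDiagClass b c, ∑ k ∈ Finset.univ.filter (fun k => a k = j),
        G (Function.update a k i) =
      (c i j + 1) • ∑ a ∈ offDiagClass b (addEntry c i j 1), G a := by
  have hR : (c i j + 1) • ∑ a ∈ offDiagClass b (addEntry c i j 1), G a =
      ∑ a ∈ offDiagClass b (addEntry c i j 1),
        ∑ k ∈ Finset.univ.filter (fun k => a k = i ∧ b k = j), G a := by
    rw [Finset.smul_sum]
    refine Finset.sum_congr rfl fun a ha => ?_
    have h1 := mem_offDiagClass.mp ha i j hij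
    simp only [addEntry, Matrix.of_apply, and_self, if_true] at h1
    rw [Finset.sum_const, ← h1]
    rfl
  have hb : ∀ a ∈ offDiagClass b c, ∀ k, a k = j → b k = j := by
    intro a ha k hk
    by_contra hbk
    have h1 := mem_offDiagClass.mp ha j (b k) (Ne.symm hbk)
    rw [hc _ hbk] at h1
    simp only [Dmat, Matrix.of_apply, Finset.card_eq_zero, Finset.filter_eq_empty_iff,
      Finset.mem_univ, true_implies] at h1
    exact h1 (x := k) ⟨hk, rfl⟩
  rw [hR, Finset.sum_sigma', Finset.sum_sigma']
  refine Finset.sum_bij' (fun x _ => ⟨Function.update x.1 x.2 i, x.2⟩)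
    (fun x _ => ⟨Function.update x.1 x.2 j, x.2⟩) ?_ ?_ ?_ ?_ ?_
  · rintro ⟨a, k⟩ hx
    simp only [Finset.mem_sigma, Finset.mem_filter, Finset.mem_univ, true_and] at hx ⊢
    have hbk := hb a hx.1 k hx.2
    refine ⟨mem_offDiagClass.mpr fun i' r hir => ?_, by simp, hbk⟩
    have h1 := Dmat_update a b k i i' r
    have h2 := mem_offDiagClass.mp hx.1 i' r hir
    rw [hx.2, hbk] at h1
    have h3 : ¬ (j = i' ∧ j = r) := fun h => hir (h.1.symm.trans h.2)
    rw [if_neg h3] at h1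
    simp only [addEntry, Matrix.of_apply, ← h2, eq_comm (a := i'), eq_comm (a := r)]
    exact h1
  · rintro ⟨a, k⟩ hx
    simp only [Finset.mem_sigma, Finset.mem_filter, Finset.mem_univ, true_and] at hx ⊢
    refine ⟨mem_offDiagClass.mpr fun i' r hir => ?_, by simp⟩
    have h1 := Dmat_update a b k j i' r
    have h2 := mem_offDiagClass.mp hx.1 i' r hir
    rw [hx.2.1, hx.2.2] at h1
    have h3 : ¬ (j = i' ∧ j = r) := fun h => hir (h.1.symm.trans h.2)
    rw [if_neg h3, h2] at h1
    simp only [addEntry, Matrix.of_apply, eq_comm (a := i'), eq_comm (a := r)] at h1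
    omega
  · rintro ⟨a, k⟩ hx
    simp only [Finset.mem_sigma, Finset.mem_filter, Finset.mem_univ, true_and] at hx
    simp [← hx.2]
  · rintro ⟨a, k⟩ hx
    simp only [Finset.mem_sigma, Finset.mem_filter, Finset.mem_univ, true_and] at hx
    simp [← hx.2.1]
  · rintro ⟨a, k⟩ hx
    rfl

end Tableau

section Operators

open MvPolynomial

variable {n p : ℕ}

lemma derivation_prod {R A ι : Type*} [DecidableEq ι] [CommSemiring R] [CommSemiring A] [Algebra R A]
    (D : Derivation R A A) (s : Finset ι) (f : ι → A) :
    D (∏ k ∈ s, f k) = ∑ k ∈ s, (∏ l ∈ s.erase k, f l) * D (f k) := by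
  induction s using Finset.induction_on with
  | empty => simp
  | insert a s ha ih =>
    rw [Finset.prod_insert ha, Derivation.leibniz, ih, Finset.sum_insert ha,
      Finset.erase_insert ha, add_comm, smul_eq_mul, smul_eq_mul, Finset.mul_sum]
    congr 1
    refine Finset.sum_congr rfl fun k hk => ?_
    have hka : k ≠ a := fun h => ha (h ▸ hk)
    rw [Finset.erase_insert_of_ne hka.symm,
      Finset.prod_insert fun h => ha (Finset.mem_of_mem_erase h)]
    ring

/-- The monomial `x^{D(a,b)} = ∏_k x_{a_k,b_k}`. -/
def pairMonomial (a b : Fin n → Fin p) : MvPolynomial (Fin p × Fin p) ℂ :=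
  ∏ k, X (a k, b k)

/-- `d_{i→j}` as a derivation. -/
def dDerivation (i j : Fin p) :
    Derivation ℂ (MvPolynomial (Fin p × Fin p) ℂ) (MvPolynomial (Fin p × Fin p) ℂ) :=
  ∑ s : Fin p, (X (i, s) : MvPolynomial (Fin p × Fin p) ℂ) • pderiv (j, s)

/-- `d*_{i→j}` as a derivation. -/
def dStarDerivation (i j : Fin p) :
    Derivation ℂ (MvPolynomial (Fin p × Fin p) ℂ) (MvPolynomial (Fin p × Fin p) ℂ) :=
  ∑ s : Fin p, (X (s, j) : MvPolynomial (Fin p × Fin p) ℂ) • pderiv (s, i)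

lemma coe_dDerivation (i j : Fin p) : ⇑(dDerivation i j) = dOp p i j := by
  funext g
  have h := map_sum (Derivation.coeFnAddMonoidHom (R := ℂ))
    (fun s : Fin p => (X (i, s) : MvPolynomial (Fin p × Fin p) ℂ) • pderiv (R := ℂ) (j, s)) Finset.univ
  have h' := congrFun h g
  rw [Finset.sum_apply] at h'
  exact h'

lemma coe_dStarDerivation (i j : Fin p) : ⇑(dStarDerivation i j) = dStarOp p i j := by
  funext g
  have h := map_sum (Derivation.coeFnAddMonoidHom (R := ℂ))
    (fun s : Fin p => (X (s, j) : MvPolynomial (Fin p × Fin p) ℂ) • pderiv (R := ℂ) (s, i)) Finset.univ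
  have h' := congrFun h g
  rw [Finset.sum_apply] at h'
  exact h'

lemma dDerivation_X (i j a b : Fin p) :
    dDerivation i j (X (a, b)) = if a = j then X (i, b) else 0 := by
  rw [coe_dDerivation]
  simp only [dOp, pderiv_X, Pi.single_apply, Prod.mk.injEq, mul_ite, mul_one, mul_zero]
  by_cases h : a = j
  · simp [h]
  · simp [h]

lemma dStarDerivation_X (i j a b : Fin p) :
    dStarDerivation i j (X (a, b)) = if b = i then X (a, j) else 0 := by
  rw [coe_dStarDerivation]
  simp only [dStarOp, pderiv_X, Pi.single_apply, Prod.mk.injEq, mul_ite, mul_one, mul_zero]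
  by_cases h : b = i
  · simp [h]
  · simp [h]

lemma dDerivation_pairMonomial (i j : Fin p) (a b : Fin n → Fin p) :
    dDerivation i j (pairMonomial a b) =
      ∑ k ∈ Finset.univ.filter (fun k => a k = j), pairMonomial (Function.update a k i) b := by
  rw [pairMonomial, derivation_prod, Finset.sum_filter]
  refine Finset.sum_congr rfl fun k _ => ?_
  rw [dDerivation_X]
  split_ifs
  · rw [pairMonomial, ← Finset.prod_erase_mul _ _ (Finset.mem_univ k), Function.update_self]
    congr 1
    refine Finset.prod_congr rfl fun l hl => ?_
    rw [Function.update_of_ne (Finset.ne_of_mem_erase hl)]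
  · rw [mul_zero]

lemma dStarDerivation_pairMonomial (i j : Fin p) (a b : Fin n → Fin p) :
    dStarDerivation j i (pairMonomial a b) =
      ∑ k ∈ Finset.univ.filter (fun k => b k = j), pairMonomial a (Function.update b k i) := by
  rw [pairMonomial, derivation_prod, Finset.sum_filter]
  refine Finset.sum_congr rfl fun k _ => ?_
  rw [dStarDerivation_X]
  split_ifs
  · rw [pairMonomial, ← Finset.prod_erase_mul _ _ (Finset.mem_univ k), Function.update_self]
    congr 1
    refine Finset.prod_congr rfl fun l hl => ?_
    rw [Function.update_of_ne (Finset.ne_of_mem_erase hl)]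
  · rw [mul_zero]

/-- The signed sum of `G (σ a)` over `σ ∈ C` and `a` in an off-diagonal class. -/
def antiSum {M : Type*} [AddCommGroup M] (C : Finset (Equiv.Perm (Fin n))) (b : Fin n → Fin p)
    (G : (Fin n → Fin p) → M) (c : Matrix (Fin p) (Fin p) ℕ) : M :=
  ∑ σ ∈ C, (Equiv.Perm.sign σ : ℤ) • ∑ a ∈ offDiagClass b c, G fun k => a (σ⁻¹ k)

lemma map_antiSum {M N : Type*} [AddCommGroup M] [AddCommGroup N]
    (f : M →+ N) (C : Finset (Equiv.Perm (Fin n))) (b : Fin n → Fin p)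
    (G : (Fin n → Fin p) → M) (c : Matrix (Fin p) (Fin p) ℕ) :
    f (antiSum C b G c) = antiSum C b (fun a => f (G a)) c := by
  simp [antiSum, map_sum, map_zsmul]

lemma antiSum_nsmul {M : Type*} [AddCommGroup M] (C : Finset (Equiv.Perm (Fin n)))
    (b : Fin n → Fin p) (m : ℕ) (G : (Fin n → Fin p) → M) (c : Matrix (Fin p) (Fin p) ℕ) :
    antiSum C b (fun a => m • G a) c = m • antiSum C b G c :=
  (map_antiSum (DistribSMul.toAddMonoidHom M m) C b G c).symm

lemma antiSum_sum {M ι : Type*} [AddCommGroup M] (C : Finset (Equiv.Perm (Fin n)))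
    (b : Fin n → Fin p) (s : Finset ι) (G : ι → (Fin n → Fin p) → M)
    (c : Matrix (Fin p) (Fin p) ℕ) :
    antiSum C b (fun a => ∑ k ∈ s, G k a) c = ∑ k ∈ s, antiSum C b (G k) c := by
  simp only [antiSum]
  rw [Finset.sum_comm]
  refine Finset.sum_congr rfl fun σ _ => ?_
  rw [← Finset.smul_sum, Finset.sum_comm]

lemma antiSum_update {M : Type*} [AddCommGroup M] (C : Finset (Equiv.Perm (Fin n)))
    (b : Fin n → Fin p) (G : (Fin n → Fin p) → M) (c : Matrix (Fin p) (Fin p) ℕ) {i j : Fin p}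
    (hij : i ≠ j) (hc : ∀ r, r ≠ j → c j r = 0) :
    antiSum C b (fun a => ∑ k ∈ Finset.univ.filter (fun k => a k = j),
        G (Function.update a k i)) c =
      (c i j + 1) • antiSum C b G (addEntry c i j 1) := by
  rw [← antiSum_nsmul]
  refine Finset.sum_congr rfl fun σ _ => ?_
  rw [← Finset.smul_sum, ← sum_offDiagClass_update (fun a => G fun k => a (σ⁻¹ k)) b c hij hc]
  congr 1
  refine Finset.sum_congr rfl fun a _ => ?_
  symm
  refine Finset.sum_equiv σ (fun k => by simp) fun k _ => ?_
  congr 1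
  funext l
  by_cases h : l = σ k
  · subst h; simp
  · rw [Function.update_of_ne h, Function.update_of_ne]
    intro h'
    exact h (by rw [← h']; simp)

/-- The pairing of two antisymmetrised sums over off-diagonal classes. -/
def classPairing (C : Finset (Equiv.Perm (Fin n))) (b : Fin n → Fin p)
    (c c' : Matrix (Fin p) (Fin p) ℕ) : MvPolynomial (Fin p × Fin p) ℂ :=
  antiSum C b (fun a => antiSum C b (fun a' => pairMonomial a a') c') c

lemma dOp_classPairing (C : Finset (Equiv.Perm (Fin n))) (b : Fin n → Fin p)
    (c c' : Matrix (Fin p) (Fin p) ℕ) {i j : Fin p} (hij : i ≠ j)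
    (hc : ∀ r, r ≠ j → c j r = 0) :
    dOp p i j (classPairing C b c c') = (c i j + 1) • classPairing C b (addEntry c i j 1) c' := by
  rw [← coe_dDerivation]
  have h := map_antiSum (dDerivation i j).toLinearMap.toAddMonoidHom C b
    (fun a => antiSum C b (fun a' => pairMonomial a a') c') c
  refine h.trans ?_
  rw [classPairing, ← antiSum_update C b _ c hij hc]
  congr 1
  funext a
  refine (map_antiSum (dDerivation i j).toLinearMap.toAddMonoidHom C b _ c').trans ?_
  rw [← antiSum_sum]
  congr 1
  funext a'
  exact dDerivation_pairMonomial i j a a'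

lemma dStarOp_classPairing (C : Finset (Equiv.Perm (Fin n))) (b : Fin n → Fin p)
    (c c' : Matrix (Fin p) (Fin p) ℕ) {i j : Fin p} (hij : i ≠ j)
    (hc : ∀ r, r ≠ j → c' j r = 0) :
    dStarOp p j i (classPairing C b c c') =
      (c' i j + 1) • classPairing C b c (addEntry c' i j 1) := by
  rw [← coe_dStarDerivation]
  have h := map_antiSum (dStarDerivation j i).toLinearMap.toAddMonoidHom C b
    (fun a => antiSum C b (fun a' => pairMonomial a a') c') c
  refine h.trans ?_
  rw [classPairing, ← antiSum_nsmul]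
  congr 1
  funext a
  refine (map_antiSum (dStarDerivation j i).toLinearMap.toAddMonoidHom C b _ c').trans ?_
  rw [← antiSum_update C b _ c' hij hc]
  congr 1
  funext a'
  exact dStarDerivation_pairMonomial i j a a'

lemma iterate_addEntry {M : Type*} [AddCommMonoid M] (d : M → M)
    (hd : ∀ (m : ℕ) x, d (m • x) = m • d x) (F : Matrix (Fin p) (Fin p) ℕ → M) {i j : Fin p}
    (hij : i ≠ j)
    (hF : ∀ c : Matrix (Fin p) (Fin p) ℕ, (∀ r, r ≠ j → c j r = 0) →
      d (F c) = (c i j + 1) • F (addEntry c i j 1))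
    (c : Matrix (Fin p) (Fin p) ℕ) (hc : ∀ r, r ≠ j → c j r = 0) (hcij : c i j = 0) (m : ℕ) :
    d^[m] (F c) = m.factorial • F (addEntry c i j m) := by
  induction m with
  | zero =>
    have : addEntry c i j 0 = c := by ext; simp [addEntry]
    simp [this]
  | succ m ih =>
    rw [Function.iterate_succ_apply', ih, hd, hF]
    · have h1 : addEntry (addEntry c i j m) i j 1 = addEntry c i j (m + 1) := by
        ext i' r
        simp only [addEntry, Matrix.of_apply]
        split_ifs <;> omega
      rw [h1, smul_smul]
      congr 1
      simp [addEntry, hcij, Nat.factorial_succ, mul_comm]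
    · intro r hr
      simp [addEntry, hc r hr, hij.symm]

lemma iterate_nsmul {M : Type*} [AddCommMonoid M] (d : M → M)
    (hd : ∀ (m : ℕ) x, d (m • x) = m • d x) (k m : ℕ) (x : M) :
    d^[k] (m • x) = m • d^[k] x := by
  induction k with
  | zero => rfl
  | succ k ih => rw [Function.iterate_succ_apply', ih, hd, Function.iterate_succ_apply']

lemma dOp_nsmul (i j : Fin p) (m : ℕ) (g : MvPolynomial (Fin p × Fin p) ℂ) :
    dOp p i j (m • g) = m • dOp p i j g := by
  rw [← coe_dDerivation, map_nsmul]

lemma dStarOp_nsmul (i j : Fin p) (m : ℕ) (g : MvPolynomial (Fin p × Fin p) ℂ) :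
    dStarOp p i j (m • g) = m • dStarOp p i j g := by
  rw [← coe_dStarDerivation, map_nsmul]

/-- The entries of `c` at the positions listed in `L`. -/
def maskEntries (L : List (Fin p × Fin p)) (c : Matrix (Fin p) (Fin p) ℕ) :
    Matrix (Fin p) (Fin p) ℕ :=
  Matrix.of fun i j => if (i, j) ∈ L then c i j else 0

lemma addEntry_maskEntries (L : List (Fin p × Fin p)) (c : Matrix (Fin p) (Fin p) ℕ)
    {x : Fin p × Fin p} (hx : x ∉ L) :
    addEntry (maskEntries L c) x.1 x.2 (c x.1 x.2) = maskEntries (x :: L) c := by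
  ext i j
  simp only [addEntry, maskEntries, Matrix.of_apply, List.mem_cons]
  by_cases h : (i, j) = x
  · subst h; simp [hx]
  · have h' : ¬ (i = x.1 ∧ j = x.2) := fun h' => h (Prod.ext h'.1 h'.2)
    simp [h, h']

lemma foldr_classPairing (C : Finset (Equiv.Perm (Fin n))) (b : Fin n → Fin p)
    (D' D'' : Matrix (Fin p) (Fin p) ℕ) (L : List (Fin p × Fin p)) (hL : L.Nodup)
    (hne : ∀ x ∈ L, x.1 ≠ x.2) (hpw : L.Pairwise fun x y => y.1 ≠ x.2) :
    (L.map fun x => (dOp p x.1 x.2)^[D'' x.1 x.2] ∘ (dStarOp p x.2 x.1)^[D' x.1 x.2]).foldr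
        (· ∘ ·) id (classPairing C b 0 0) =
      (L.map fun x => (D' x.1 x.2).factorial * (D'' x.1 x.2).factorial).prod •
        classPairing C b (maskEntries L D'') (maskEntries L D') := by
  induction L with
  | nil =>
    have : ∀ c : Matrix (Fin p) (Fin p) ℕ, maskEntries [] c = 0 := by
      intro c; ext; simp [maskEntries]
    simp [this]
  | cons x L ih =>
    rw [List.nodup_cons] at hL
    rw [List.pairwise_cons] at hpw
    have hx := hne x (by simp)
    have hcol : ∀ c : Matrix (Fin p) (Fin p) ℕ, ∀ r, r ≠ x.2 → maskEntries L c x.2 r = 0 := by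
      intro c r _
      simp only [maskEntries, Matrix.of_apply]
      rw [if_neg]
      intro h
      exact hpw.1 _ h rfl
    have hzero : ∀ c : Matrix (Fin p) (Fin p) ℕ, maskEntries L c x.1 x.2 = 0 := by
      intro c
      simp only [maskEntries, Matrix.of_apply]
      exact if_neg hL.1
    rw [List.map_cons, List.foldr_cons, Function.comp_apply,
      ih hL.2 (fun y hy => hne y (by simp [hy])) hpw.2, Function.comp_apply,
      iterate_nsmul _ (dStarOp_nsmul _ _), iterate_nsmul _ (dOp_nsmul _ _),
      iterate_addEntry (dStarOp p x.2 x.1) (dStarOp_nsmul _ _) (classPairing C b _) hx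
        (fun c hc => dStarOp_classPairing C b _ c hx hc) _ (hcol D') (hzero D'),
      iterate_nsmul _ (dOp_nsmul _ _),
      iterate_addEntry (dOp p x.1 x.2) (dOp_nsmul _ _) (fun c => classPairing C b c _) hx
        (fun c hc => dOp_classPairing C b c _ hx hc) _ (hcol D'') (hzero D''),
      addEntry_maskEntries L D' hL.1, addEntry_maskEntries L D'' hL.1, smul_smul, smul_smul,
      List.map_cons, List.prod_cons]
    congr 1
    ring

/-- The positions `(i, j)` with `j < i`, ordered lexicographically by `(j, i)`. -/
def lowerPairs (p : ℕ) : List (Fin p × Fin p) :=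
  (List.finRange p).flatMap fun j =>
    ((List.finRange p).filter fun i => decide (j < i)).map fun i => (i, j)

lemma mem_lowerPairs (x : Fin p × Fin p) : x ∈ lowerPairs p ↔ x.2 < x.1 := by
  simp only [lowerPairs, List.mem_flatMap, List.mem_map, List.mem_filter, List.mem_finRange,
    true_and, decide_eq_true_eq]
  constructor
  · rintro ⟨j, i, h, rfl⟩
    exact h
  · intro h
    exact ⟨x.2, x.1, h, rfl⟩

lemma lowerPairs_nodup (p : ℕ) : (lowerPairs p).Nodup := by
  rw [lowerPairs, List.nodup_flatMap]
  constructor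
  · intro j _
    exact ((List.nodup_finRange p).filter _).map fun i i' h => (Prod.mk.inj h).1
  · refine (List.nodup_finRange p).imp fun {j j'} h => ?_
    simp only [Function.onFun, List.disjoint_left, List.mem_map]
    rintro _ ⟨i, _, rfl⟩ ⟨i', _, h'⟩
    exact h (Prod.mk.inj h').2.symm

lemma lowerPairs_pairwise (p : ℕ) : (lowerPairs p).Pairwise fun x y => y.1 ≠ x.2 := by
  rw [lowerPairs, List.pairwise_flatMap]
  constructor
  · intro j _
    rw [List.pairwise_map]
    refine List.Pairwise.filter _ ?_ |>.imp_of_mem (R := fun _ _ => True) ?_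
    · exact List.pairwise_of_forall fun _ _ => trivial
    · intro a b _ hb _
      simp only [List.mem_filter, decide_eq_true_eq] at hb
      exact hb.2.ne'
  · refine (List.pairwise_lt_finRange p).imp fun {j j'} h => ?_
    simp only [List.mem_map, List.mem_filter, decide_eq_true_eq]
    rintro _ ⟨i, ⟨_, hi⟩, rfl⟩ _ ⟨i', ⟨_, hi'⟩, rfl⟩
    exact (h.trans hi').ne'

lemma foldr_comp_flatMap {α β : Type*} (l : List α) (g : α → List (β → β)) :
    (l.map fun j => (g j).foldr (· ∘ ·) id).foldr (· ∘ ·) id =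
      (l.flatMap g).foldr (· ∘ ·) id := by
  have happ : ∀ l₁ l₂ : List (β → β), (l₁ ++ l₂).foldr (· ∘ ·) id =
      l₁.foldr (· ∘ ·) id ∘ l₂.foldr (· ∘ ·) id := by
    intro l₁ l₂
    induction l₁ with
    | nil => rfl
    | cons f l₁ ih => simp [ih, Function.comp_assoc]
  induction l with
  | nil => rfl
  | cons a l ih => rw [List.flatMap_cons, happ, List.map_cons, List.foldr_cons, ih]

lemma opProd_eq_foldr (D' D'' : Matrix (Fin p) (Fin p) ℕ) :
    opProd p D' D'' =
      ((lowerPairs p).map fun x =>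
        (dOp p x.1 x.2)^[D'' x.1 x.2] ∘ (dStarOp p x.2 x.1)^[D' x.1 x.2]).foldr (· ∘ ·) id := by
  rw [opProd, foldr_comp_flatMap, lowerPairs, List.map_flatMap]
  simp only [List.map_map, Function.comp_def]

lemma opProd_classPairing (C : Finset (Equiv.Perm (Fin n))) (b : Fin n → Fin p)
    (D' D'' : Matrix (Fin p) (Fin p) ℕ) :
    opProd p D' D'' (classPairing C b 0 0) =
      (∏ x ∈ (Finset.univ : Finset (Fin p × Fin p)).filter (fun x => x.2 < x.1),
        ((D' x.1 x.2).factorial * (D'' x.1 x.2).factorial)) •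
        classPairing C b (maskEntries (lowerPairs p) D'') (maskEntries (lowerPairs p) D') := by
  rw [opProd_eq_foldr, foldr_classPairing C b D' D'' _ (lowerPairs_nodup p)
    (fun x hx => ((mem_lowerPairs x).mp hx).ne') (lowerPairs_pairwise p)]
  congr 1
  rw [← List.prod_toFinset _ (lowerPairs_nodup p)]
  congr 1
  ext x
  simp [mem_lowerPairs]

lemma offDiagClass_maskEntries_lowerPairs (b : Fin n → Fin p) (c : Matrix (Fin p) (Fin p) ℕ)
    (hc : ∀ i j, i < j → c i j = 0) :
    offDiagClass b (maskEntries (lowerPairs p) c) = offDiagClass b c := by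
  ext a
  rw [mem_offDiagClass, mem_offDiagClass]
  refine forall₃_congr fun i r hir => ?_
  simp only [maskEntries, Matrix.of_apply, mem_lowerPairs]
  split_ifs with h
  · rfl
  · rw [hc i r (lt_of_le_of_ne (not_lt.mp h) hir)]

lemma classPairing_maskEntries_lowerPairs (C : Finset (Equiv.Perm (Fin n))) (b : Fin n → Fin p)
    (c c' : Matrix (Fin p) (Fin p) ℕ) (hc : ∀ i j, i < j → c i j = 0)
    (hc' : ∀ i j, i < j → c' i j = 0) :
    classPairing C b (maskEntries (lowerPairs p) c) (maskEntries (lowerPairs p) c') =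
      classPairing C b c c' := by
  simp only [classPairing, antiSum, offDiagClass_maskEntries_lowerPairs b c hc,
    offDiagClass_maskEntries_lowerPairs b c' hc']

end Operators

section Evaluation

open MvPolynomial

variable {n p : ℕ}

lemma monomial_expOf_Dmat (a b : Fin n → Fin p) :
    monomial (expOf p (Dmat a b)) (1 : ℂ) = pairMonomial a b := by
  have : expOf p (Dmat a b) = ∑ k, Finsupp.single (a k, b k) 1 := by
    ext ⟨i, j⟩
    rw [Finsupp.finsetSum_apply]
    simp [expOf, Dmat, Finsupp.single_apply]
  rw [this, monomial_sum_one]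
  rfl

lemma sum_sum_Dmat (a b : Fin n → Fin p) : ∑ i, ∑ j, Dmat a b i j = n := by
  refine Finset.sum_comm.trans ?_
  refine (Finset.sum_congr rfl fun r _ => sum_Dmat a b r).trans ?_
  rw [← Finset.card_eq_sum_card_fiberwise (f := b) (t := Finset.univ) (by simp)]
  simp

lemma Dmat_le (a b : Fin n → Fin p) (i j : Fin p) : Dmat a b i j ≤ n := by
  simp only [Dmat, Matrix.of_apply]
  exact (Finset.card_le_univ _).trans (by simp)

lemma sum_monomial_sinner (x y : (Fin n → Fin p) → ℂ) :
    (∑ D ∈ (Finset.univ : Finset (Fin p → Fin p → Fin (n + 1))).filter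
          (fun D => ∑ i, ∑ j, (D i j : ℕ) = n),
        monomial (expOf p (Matrix.of fun i j => (D i j : ℕ)))
          (sinner ((AD n p (Matrix.of fun i j => (D i j : ℕ))).mulVec x) y)) =
      ∑ a, (starRingEnd ℂ) (y a) • ∑ b, x b • pairMonomial a b := by
  have h1 : ∀ D : Fin p → Fin p → Fin (n + 1),
      monomial (expOf p (Matrix.of fun i j => (D i j : ℕ)))
          (sinner ((AD n p (Matrix.of fun i j => (D i j : ℕ))).mulVec x) y) =
        ∑ a, ∑ b, if Dmat a b = Matrix.of fun i j => (D i j : ℕ) then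
          (starRingEnd ℂ) (y a) • x b • pairMonomial a b else 0 := by
    intro D
    rw [sinner, map_sum]
    refine Finset.sum_congr rfl fun a _ => ?_
    rw [Matrix.mulVec, dotProduct, Finset.sum_mul, map_sum]
    refine Finset.sum_congr rfl fun b _ => ?_
    simp only [AD, Matrix.of_apply]
    split_ifs with h
    · rw [← h, ← monomial_expOf_Dmat, smul_monomial, smul_monomial]
      congr 1
      simp [mul_comm]
    · simp
  simp_rw [h1]
  rw [Finset.sum_comm]
  refine Finset.sum_congr rfl fun a _ => ?_
  rw [Finset.sum_comm, Finset.smul_sum]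
  refine Finset.sum_congr rfl fun b _ => ?_
  rw [Finset.sum_eq_single
    (fun i j => (⟨Dmat a b i j, Nat.lt_succ_of_le (Dmat_le a b i j)⟩ : Fin (n + 1)))]
  · rw [if_pos]
    rfl
  · intro D _ hD
    rw [if_neg]
    intro h
    apply hD
    funext i j
    apply Fin.ext
    simp [h]
  · intro h
    exact absurd (by simpa using sum_sum_Dmat a b) h

lemma sum_eT_smul {M : Type*} [AddCommGroup M] [Module ℂ M] (hp : 0 < p) (lam : Fin p → ℕ)
    (hsum : ∑ i, lam i = n) (t : Fin n → Fin p) (G : (Fin n → Fin p) → M) :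
    ∑ a, eT n p lam t a • G a =
      antiSum (colGroup n p lam) (tLam n p hp lam) G (Dmat t (tLam n p hp lam)) := by
  rw [← Fintype.linearCombination_apply ℂ G, eT, rowEquivalent_eq_offDiagClass hp lam hsum]
  simp only [map_sum, map_smul, Fintype.linearCombination_apply_single, one_smul, antiSum]
  refine Finset.sum_congr rfl fun σ _ => ?_
  rw [Int.cast_smul_eq_zsmul]

lemma star_eT (lam : Fin p → ℕ) (t a : Fin n → Fin p) :
    (starRingEnd ℂ) (eT n p lam t a) = eT n p lam t a := by
  simp only [eT, Finset.sum_apply, Pi.smul_apply, smul_eq_mul, map_sum, map_mul,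
    Pi.single_apply, apply_ite (starRingEnd ℂ), map_one, map_zero]
  simp

lemma card_col (hp : 0 < p) (lam : Fin p → ℕ) (hdec : ∀ i j : Fin p, i ≤ j → lam j ≤ lam i)
    (hsum : ∑ i, lam i = n) (c : ℕ) :
    ∃ e : {k : Fin n // colOf p lam k = c} ≃ Fin (conjPart p lam (c + 1)),
      ∀ k, (e k : ℕ) = rowOf p lam (k : Fin n) := by
  have hrow : ∀ i : Fin p, c + 1 ≤ lam i ↔ (i : ℕ) < conjPart p lam (c + 1) := fun i =>
    mem_iff_lt_card_of_lower (fun i => c + 1 ≤ lam i) (fun i j hij h => h.trans (hdec i j hij)) i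
  have hle : conjPart p lam (c + 1) ≤ p := by
    unfold conjPart
    exact (Finset.card_le_univ _).trans (by simp)
  have hlt : ∀ k : {k : Fin n // colOf p lam k = c},
      rowOf p lam (k : Fin n) < conjPart p lam (c + 1) := by
    rintro ⟨k, hk⟩
    have hr := rowOf_lt lam hp hsum k
    refine (hrow ⟨_, hr⟩).mp ?_
    have := colOf_lt lam k hr
    omega
  refine ⟨Equiv.ofBijective (fun k => ⟨rowOf p lam (k : Fin n), hlt k⟩) ⟨?_, ?_⟩, fun k => rfl⟩
  · rintro ⟨k, hk⟩ ⟨l, hl⟩ h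
    exact Subtype.ext (box_ext lam (Fin.mk.inj h) (hk.trans hl.symm))
  · rintro ⟨r, hr⟩
    obtain ⟨k, h1, h2⟩ := exists_box lam hsum ⟨r, hr.trans_le hle⟩ c ((hrow _).mpr hr)
    exact ⟨⟨k, h2⟩, Fin.ext h1⟩

lemma mem_colGroup {lam : Fin p → ℕ} {σ : Equiv.Perm (Fin n)} :
    σ ∈ colGroup n p lam ↔ ∀ k : Fin n, colOf p lam (σ k : ℕ) = colOf p lam (k : ℕ) := by
  simp [colGroup]

lemma colOf_inv {lam : Fin p → ℕ} {σ : Equiv.Perm (Fin n)} (hσ : σ ∈ colGroup n p lam)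
    (k : Fin n) : colOf p lam (σ⁻¹ k : Fin n) = colOf p lam k := by
  have := mem_colGroup.mp hσ (σ⁻¹ k)
  rw [← this, ← Equiv.Perm.mul_apply, mul_inv_cancel, Equiv.Perm.one_apply]

/-- The column index of a box, as an element of `Fin n`. -/
def colFin (n : ℕ) (lam : Fin p → ℕ) (k : Fin n) : Fin n :=
  ⟨colOf p lam k, (Nat.sub_le _ _).trans_lt k.2⟩

lemma card_colGroup (hp : 0 < p) (lam : Fin p → ℕ)
    (hdec : ∀ i j : Fin p, i ≤ j → lam j ≤ lam i) (hsum : ∑ i, lam i = n) :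
    (colGroup n p lam).card = ∏ c : Fin n, (conjPart p lam (c + 1)).factorial := by
  have h := DomMulAct.stabilizer_card (colFin n lam)
  have h1 : ∀ c : Fin n, Fintype.card {k // colFin n lam k = c} = conjPart p lam (c + 1) := by
    intro c
    obtain ⟨e, -⟩ := card_col hp lam hdec hsum c
    have e' : {k : Fin n // colFin n lam k = c} ≃ {k : Fin n // colOf p lam k = c} :=
      Equiv.subtypeEquivRight fun k => by simp [colFin, Fin.ext_iff]
    simpa using Fintype.card_congr (e'.trans e)
  simp_rw [h1] at h
  rw [← h, Fintype.card_subtype]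
  congr 1
  ext σ
  simp [mem_colGroup, funext_iff, colFin, Fin.ext_iff]

lemma sum_colGroup_eq_prod_det (hp : 0 < p) (lam : Fin p → ℕ)
    (hdec : ∀ i j : Fin p, i ≤ j → lam j ≤ lam i) (hsum : ∑ i, lam i = n) :
    ∑ ρ ∈ colGroup n p lam, (Equiv.Perm.sign ρ : ℤ) •
        pairMonomial (fun k => tLam n p hp lam (ρ k)) (tLam n p hp lam) =
      ∏ c : Fin n, Matrix.det (Matrix.of fun i j : Fin (conjPart p lam (c + 1)) =>
        if h : (i : ℕ) < p ∧ (j : ℕ) < p then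
          (X (⟨i, h.1⟩, ⟨j, h.2⟩) : MvPolynomial (Fin p × Fin p) ℂ) else 0) := by
  set M : Matrix (Fin n) (Fin n) (MvPolynomial (Fin p × Fin p) ℂ) := Matrix.of fun k l =>
    if colOf p lam k = colOf p lam l then X (tLam n p hp lam k, tLam n p hp lam l) else 0 with hM
  have htri : M.BlockTriangular (colFin n lam) := by
    intro k l hkl
    rw [hM, Matrix.of_apply, if_neg]
    intro h
    exact hkl.ne (Fin.ext h.symm)
  have hdet : M.det = ∑ ρ ∈ colGroup n p lam, (Equiv.Perm.sign ρ : ℤ) •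
      pairMonomial (fun k => tLam n p hp lam (ρ k)) (tLam n p hp lam) := by
    rw [Matrix.det_apply]
    symm
    refine Finset.sum_subset_zero_on_sdiff (Finset.subset_univ _) ?_ ?_
    · intro ρ hρ
      have hρ' : ρ ∉ colGroup n p lam := (Finset.mem_sdiff.mp hρ).2
      rw [mem_colGroup] at hρ'
      push Not at hρ'
      obtain ⟨k, hk⟩ := hρ'
      rw [Finset.prod_eq_zero (Finset.mem_univ k), smul_zero]
      rw [hM, Matrix.of_apply, if_neg hk]
    · intro ρ hρ
      rw [pairMonomial, Units.smul_def]
      congr 1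
      refine Finset.prod_congr rfl fun k _ => ?_
      rw [hM, Matrix.of_apply, if_pos (mem_colGroup.mp hρ k)]
  rw [← hdet, htri.det_fintype]
  refine Finset.prod_congr rfl fun c _ => ?_
  obtain ⟨e, he⟩ := card_col hp lam hdec hsum c
  set e' : {k : Fin n // colFin n lam k = c} ≃ Fin (conjPart p lam (c + 1)) :=
    (Equiv.subtypeEquivRight fun k => by simp [colFin, Fin.ext_iff]).trans e with he'
  rw [← Matrix.det_submatrix_equiv_self e']
  congr 1
  ext1 k l
  have hk : ∀ k, (e' k : ℕ) = tLam n p hp lam (k : Fin n) := by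
    intro k
    rw [tLam_val hp lam hsum]
    exact he _
  simp only [Matrix.toSquareBlock_def, Matrix.submatrix_apply, Matrix.of_apply, hM]
  rw [if_pos, dif_pos]
  · congr 2
    · exact Fin.ext (hk k).symm
    · exact Fin.ext (hk l).symm
  · rw [hk, hk]
    exact ⟨Fin.is_lt _, Fin.is_lt _⟩
  · exact congrArg Fin.val (k.2.trans l.2.symm)

lemma classPairing_zero (hp : 0 < p) (lam : Fin p → ℕ)
    (hdec : ∀ i j : Fin p, i ≤ j → lam j ≤ lam i) (hsum : ∑ i, lam i = n) :
    classPairing (colGroup n p lam) (tLam n p hp lam) 0 0 = Ppoly n p lam := by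
  have hinner : ∀ σ ∈ colGroup n p lam,
      (Equiv.Perm.sign σ : ℤ) • ∑ τ ∈ colGroup n p lam, (Equiv.Perm.sign τ : ℤ) •
        pairMonomial (fun k => tLam n p hp lam (σ⁻¹ k)) (fun k => tLam n p hp lam (τ⁻¹ k)) =
      ∑ ρ ∈ colGroup n p lam, (Equiv.Perm.sign ρ : ℤ) •
        pairMonomial (fun k => tLam n p hp lam (ρ k)) (tLam n p hp lam) := by
    intro σ hσ
    rw [Finset.smul_sum]
    refine Finset.sum_bij' (fun τ _ => σ⁻¹ * τ) (fun ρ _ => σ * ρ) ?_ ?_ ?_ ?_ ?_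
    · intro τ hτ
      rw [mem_colGroup]
      intro k
      rw [Equiv.Perm.mul_apply, colOf_inv hσ, mem_colGroup.mp hτ]
    · intro ρ hρ
      rw [mem_colGroup]
      intro k
      rw [Equiv.Perm.mul_apply, mem_colGroup.mp hσ, mem_colGroup.mp hρ]
    · intro τ _
      simp
    · intro ρ _
      simp
    · intro τ _
      rw [smul_smul, Equiv.Perm.sign_mul, Equiv.Perm.sign_inv, Units.val_mul]
      congr 1
      rw [pairMonomial, pairMonomial, ← Equiv.prod_comp τ]
      simp
  rw [classPairing]
  simp only [antiSum, offDiagClass_zero, Finset.sum_singleton]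
  rw [Finset.sum_congr rfl hinner, Finset.sum_const, card_colGroup hp lam hdec hsum,
    sum_colGroup_eq_prod_det hp lam hdec hsum, Ppoly, Finset.prod_range, nsmul_eq_mul,
    Nat.cast_prod, ← Finset.prod_mul_distrib]
  rfl

end Evaluation

/-- for semistandard tableaux `t', t''` of shape `λ` with
`D' = D(t', t_λ)`, `D'' = D(t'', t_λ)`,
`(∏_{i>j} D'_{i,j}! D''_{i,j}!) Σ_{D ∈ P(n,p)} x^D ⟨A_D e_{t'}, e_{t''}⟩` equals
`(∏_{j<i} (d_{i→j})^{D''_{i,j}} (d*_{j→i})^{D'_{i,j}})` applied to `P_λ`. -/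
theorem stmt_11 (n p : ℕ) (hn : 1 ≤ n) (hp : 0 < p) (lam : Fin p → ℕ)
    (hdec : ∀ i j : Fin p, i ≤ j → lam j ≤ lam i) (hsum : ∑ i, lam i = n)
    (t' t'' : Fin n → Fin p)
    (ht' : IsSemistandard n p lam t') (ht'' : IsSemistandard n p lam t'') :
    ((∏ ij ∈ (Finset.univ : Finset (Fin p × Fin p)).filter (fun ij => ij.2 < ij.1),
        ((Dmat t' (tLam n p hp lam) ij.1 ij.2).factorial *
          (Dmat t'' (tLam n p hp lam) ij.1 ij.2).factorial) : ℕ) : ℂ) •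
      (∑ D ∈ (Finset.univ : Finset (Fin p → Fin p → Fin (n + 1))).filter
          (fun D => ∑ i, ∑ j, (D i j : ℕ) = n),
        MvPolynomial.monomial (expOf p (Matrix.of fun i j => (D i j : ℕ)))
          (sinner ((AD n p (Matrix.of fun i j => (D i j : ℕ))).mulVec (eT n p lam t'))
            (eT n p lam t''))) =
      opProd p (Dmat t' (tLam n p hp lam)) (Dmat t'' (tLam n p hp lam))
        (Ppoly n p lam) := by
  rw [sum_monomial_sinner]
  simp_rw [star_eT, sum_eT_smul hp lam hsum]
  rw [← classPairing_zero hp lam hdec hsum, opProd_classPairing, Nat.cast_smul_eq_nsmul,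
    classPairing_maskEntries_lowerPairs _ _ _ _
      (fun i j => ht''.Dmat_eq_zero hp lam hdec hsum)
      (fun i j => ht'.Dmat_eq_zero hp lam hdec hsum), classPairing]
end
end

section
/- Let p = 2, n ≥ 1, 0 ≤ k ≤ ⌊n/2⌋, and k ≤ i', j' ≤ n−k. Let i, j, t be integers with 0 ≤ t ≤ min(i,j) and i + j − t ≤ n, and set D^t_{i,j} := [[n+t−i−j, i−t], [j−t, t]] ∈ P(n,2). Then ⟨A_{D^t_{i,j}} e_{t_{k,i'}}, e_{t_{k,j'}}⟩ = δ_{i,i'} δ_{j,j'} · 2^k · C(n−2k, i−k) · Σ_{s=0}^{j−k} (−1)^{j−t−s} C(n−k−i, s) C(i−k, j−k−s) C(k, j−t−s). -/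
open scoped Classical
open Matrix

noncomputable section

/-- The semistandard tableau `t_{k,i}` of shape `(n-k, k)`: box `b` carries the symbol
`2` (the element `1` of `Fin 2`) iff `b ≥ n - i`. -/
def tki (n i : ℕ) : Fin n → Fin 2 :=
  fun b => if (b : ℕ) < n - i then 0 else 1

/-- The matrix `D^t_{i,j} = [[n+t-i-j, i-t], [j-t, t]] ∈ P(n,2)`. -/
def Dtij (n i j t : ℕ) : Matrix (Fin 2) (Fin 2) ℕ :=
  !![n + t - i - j, i - t; j - t, t]

/-- Integer binomial coefficient `C(a,b)`, with the convention `C(a,b) = 0` if `b < 0`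
or `b > a`. -/
def zchoose (a b : ℤ) : ℤ :=
  if 0 ≤ b ∧ b ≤ a then (a.toNat).choose b.toNat else 0

/-- The sign `(-1)^z` for an integer `z`. -/
def isign (z : ℤ) : ℤ := if z % 2 = 0 then 1 else -1

/-- The number of letters `2` in a word. -/
def wt {ι : Type*} [Fintype ι] (a : ι → Fin 2) : ℕ := ∑ x, (a x : ℕ)

/-- The number of positions where both words have the letter `2`. -/
def overlap {ι : Type*} [Fintype ι] (a b : ι → Fin 2) : ℕ := ∑ x, (a x : ℕ) * (b x : ℕ)

/-- The box of the diagram of `(n - k, k)` that sits in row `x` of the `c`-th column of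
height two, respectively in the `m`-th column of height one. -/
def boxOf (n k : ℕ) (hk : k ≤ n / 2) : (Fin k × Fin 2) ⊕ Fin (n - 2 * k) → Fin n
  | Sum.inl (c, x) => ⟨c + x * (n - k), by
      have := c.2; have := x.2
      obtain h | h : (x : ℕ) = 0 ∨ (x : ℕ) = 1 := by omega
      all_goals rw [h]; omega⟩
  | Sum.inr m => ⟨k + m, by have := m.2; omega⟩

lemma boxOf_injective (n k : ℕ) (hk : k ≤ n / 2) : Function.Injective (boxOf n k hk) := by
  rintro (⟨c, x⟩ | m) (⟨d, y⟩ | l) h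
  all_goals simp only [boxOf, Fin.mk.injEq] at h
  · have := c.2; have := d.2
    fin_cases x <;> fin_cases y <;> simp [Fin.ext_iff] at h ⊢ <;> omega
  · have := c.2; have := l.2
    fin_cases x <;> simp at h <;> omega
  · have := d.2; have := m.2
    fin_cases y <;> simp at h <;> omega
  · simp [Fin.ext_iff]; omega

/-- The boxes of the diagram of `(n - k, k)`, grouped by columns. -/
def boxEquiv (n k : ℕ) (hk : k ≤ n / 2) : (Fin k × Fin 2) ⊕ Fin (n - 2 * k) ≃ Fin n :=
  Equiv.ofBijective (boxOf n k hk) <| by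
    rw [Fintype.bijective_iff_injective_and_card]
    refine ⟨boxOf_injective n k hk, ?_⟩
    simp
    omega

lemma boxEquiv_inl_zero (n k : ℕ) (hk : k ≤ n / 2) (c : Fin k) :
    (boxEquiv n k hk (Sum.inl (c, 0)) : ℕ) = c := by
  simp [boxEquiv, boxOf]

lemma boxEquiv_inl_one (n k : ℕ) (hk : k ≤ n / 2) (c : Fin k) :
    (boxEquiv n k hk (Sum.inl (c, 1)) : ℕ) = c + (n - k) := by
  simp [boxEquiv, boxOf]

lemma boxEquiv_inr (n k : ℕ) (hk : k ≤ n / 2) (m : Fin (n - 2 * k)) :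
    (boxEquiv n k hk (Sum.inr m) : ℕ) = k + m := by
  simp [boxEquiv, boxOf]

lemma rowOf_two (n k : ℕ) (b : Fin n) :
    rowOf 2 ![n - k, k] (b : ℕ) = if (b : ℕ) < n - k then 0 else 1 := by
  have hb := b.2
  have h0 : (Finset.univ.filter fun j : Fin 2 => j ≤ 0) = {0} := by decide
  have h1 : (Finset.univ.filter fun j : Fin 2 => j ≤ 1) = {0, 1} := by decide
  unfold rowOf
  rw [Finset.card_filter, Fin.sum_univ_two, h0, h1]
  simp
  split_ifs <;> omega

lemma colOf_two (n k : ℕ) (b : Fin n) :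
    colOf 2 ![n - k, k] (b : ℕ) = if (b : ℕ) < n - k then (b : ℕ) else b - (n - k) := by
  unfold colOf
  rw [rowOf_two, Finset.sum_filter, Fin.sum_univ_two]
  by_cases h : (b : ℕ) < n - k <;> simp [h]

lemma colOf_boxEquiv_inl (n k : ℕ) (hk : k ≤ n / 2) (c : Fin k) (x : Fin 2) :
    colOf 2 ![n - k, k] (boxEquiv n k hk (Sum.inl (c, x)) : ℕ) = c := by
  have := c.2
  rw [colOf_two]
  fin_cases x
  · simp only [Fin.zero_eta, boxEquiv_inl_zero]; split_ifs <;> omega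
  · simp only [Fin.mk_one, boxEquiv_inl_one]; split_ifs <;> omega

lemma colOf_boxEquiv_inr (n k : ℕ) (hk : k ≤ n / 2) (m : Fin (n - 2 * k)) :
    colOf 2 ![n - k, k] (boxEquiv n k hk (Sum.inr m) : ℕ) = k + m := by
  have := m.2
  rw [colOf_two, boxEquiv_inr]
  split_ifs <;> omega

/-- The permutation of the boxes that acts by `f c` on the `c`-th column of height two. -/
def colPerm (n k : ℕ) (hk : k ≤ n / 2) (f : Fin k → Equiv.Perm (Fin 2)) :
    Equiv.Perm (Fin n) :=
  (boxEquiv n k hk).permCongr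
    (Equiv.sumCongr (Equiv.prodCongrRight f) (Equiv.refl (Fin (n - 2 * k))))

lemma colPerm_inl (n k : ℕ) (hk : k ≤ n / 2) (f : Fin k → Equiv.Perm (Fin 2))
    (c : Fin k) (x : Fin 2) :
    colPerm n k hk f (boxEquiv n k hk (Sum.inl (c, x))) =
      boxEquiv n k hk (Sum.inl (c, f c x)) := by
  simp [colPerm, Equiv.permCongr_apply]

lemma colPerm_inr (n k : ℕ) (hk : k ≤ n / 2) (f : Fin k → Equiv.Perm (Fin 2))
    (m : Fin (n - 2 * k)) :
    colPerm n k hk f (boxEquiv n k hk (Sum.inr m)) = boxEquiv n k hk (Sum.inr m) := by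
  simp [colPerm, Equiv.permCongr_apply]

lemma sign_colPerm (n k : ℕ) (hk : k ≤ n / 2) (f : Fin k → Equiv.Perm (Fin 2)) :
    Equiv.Perm.sign (colPerm n k hk f) = ∏ c, Equiv.Perm.sign (f c) := by
  unfold colPerm
  rw [Equiv.Perm.sign_permCongr]
  have := Equiv.Perm.sign_sumCongr (Equiv.prodCongrRight f) (1 : Equiv.Perm (Fin (n - 2 * k)))
  rwa [Equiv.Perm.sign_prodCongrRight, Equiv.Perm.sign_one, mul_one] at this

lemma colPerm_injective (n k : ℕ) (hk : k ≤ n / 2) :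
    Function.Injective (colPerm n k hk) := by
  intro f g h
  funext c
  ext1 x
  have := congrArg (fun σ => σ (boxEquiv n k hk (Sum.inl (c, x)))) h
  simpa [colPerm_inl] using this

lemma mem_colGroup_iff (n k : ℕ) (hk : k ≤ n / 2) (σ : Equiv.Perm (Fin n)) :
    σ ∈ colGroup n 2 ![n - k, k] ↔ ∃ f, colPerm n k hk f = σ := by
  constructor
  · intro h
    replace h : ∀ b : Fin n, colOf 2 ![n - k, k] (σ b : ℕ) = colOf 2 ![n - k, k] (b : ℕ) := by
      simpa [colGroup] using h
    have hl : ∀ c x, ∃ y, σ (boxEquiv n k hk (Sum.inl (c, x))) =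
        boxEquiv n k hk (Sum.inl (c, y)) := by
      intro c x
      have hc := h (boxEquiv n k hk (Sum.inl (c, x)))
      obtain ⟨z, hz⟩ := (boxEquiv n k hk).surjective (σ (boxEquiv n k hk (Sum.inl (c, x))))
      rw [← hz] at hc ⊢
      rw [colOf_boxEquiv_inl] at hc
      rcases z with ⟨d, y⟩ | m
      · rw [colOf_boxEquiv_inl] at hc
        exact ⟨y, by rw [Fin.ext hc]⟩
      · rw [colOf_boxEquiv_inr] at hc
        have := c.2
        omega
    have hr : ∀ m, σ (boxEquiv n k hk (Sum.inr m)) = boxEquiv n k hk (Sum.inr m) := by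
      intro m
      have hc := h (boxEquiv n k hk (Sum.inr m))
      obtain ⟨z, hz⟩ := (boxEquiv n k hk).surjective (σ (boxEquiv n k hk (Sum.inr m)))
      rw [← hz] at hc ⊢
      rw [colOf_boxEquiv_inr] at hc
      rcases z with ⟨d, y⟩ | l
      · rw [colOf_boxEquiv_inl] at hc
        have := d.2
        omega
      · rw [colOf_boxEquiv_inr] at hc
        rw [Fin.ext (Nat.add_left_cancel hc)]
    choose y hy using hl
    have hinj : ∀ c, Function.Injective (y c) := by
      intro c x x' hx
      have : σ (boxEquiv n k hk (Sum.inl (c, x))) = σ (boxEquiv n k hk (Sum.inl (c, x'))) := by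
        rw [hy, hy, hx]
      simpa using this
    refine ⟨fun c => Equiv.ofBijective (y c) (Finite.injective_iff_bijective.mp (hinj c)), ?_⟩
    ext1 b
    obtain ⟨⟨c, x⟩ | m, rfl⟩ := (boxEquiv n k hk).surjective b
    · rw [colPerm_inl, hy]; rfl
    · rw [colPerm_inr, hr]
  · rintro ⟨f, rfl⟩
    simp only [colGroup, Finset.mem_filter, Finset.mem_univ, true_and]
    intro b
    obtain ⟨⟨c, x⟩ | m, rfl⟩ := (boxEquiv n k hk).surjective b
    · rw [colPerm_inl, colOf_boxEquiv_inl, colOf_boxEquiv_inl]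
    · rw [colPerm_inr]

lemma colGroup_eq_image (n k : ℕ) (hk : k ≤ n / 2) :
    colGroup n 2 ![n - k, k] = Finset.univ.image (colPerm n k hk) := by
  ext σ
  rw [mem_colGroup_iff n k hk]
  simp

lemma mem_rowGroup_iff (n k : ℕ) (π : Equiv.Perm (Fin n)) :
    π ∈ rowGroup n 2 ![n - k, k] ↔
      ∀ b : Fin n, ((π b : ℕ) < n - k ↔ (b : ℕ) < n - k) := by
  simp only [rowGroup, Finset.mem_filter, Finset.mem_univ, true_and, rowOf_two]
  refine forall_congr' fun b => ?_
  split_ifs with h1 h2 h2 <;> simp only [h1, h2] <;> decide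

lemma wt_eq_card {ι : Type*} [Fintype ι] (a : ι → Fin 2) :
    wt a = (Finset.univ.filter fun x => a x = 1).card := by
  rw [Finset.card_filter]
  refine Finset.sum_congr rfl fun x _ => ?_
  generalize a x = y
  fin_cases y <;> simp

lemma wt_comp_equiv {ι κ : Type*} [Fintype ι] [Fintype κ] (a : ι → Fin 2) (e : κ ≃ ι) :
    wt (fun x => a (e x)) = wt a :=
  Equiv.sum_comp e fun x => (a x : ℕ)

lemma wt_tki (n i : ℕ) (hi : i ≤ n) : wt (tki n i) = i := by
  unfold wt tki
  rw [Fin.sum_univ_eq_sum_range (fun b => (((if b < n - i then 0 else 1 : Fin 2)) : ℕ)) n]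
  have : n = (n - i) + i := by omega
  rw [Finset.sum_congr (congrArg Finset.range this) (fun _ _ => rfl), Finset.sum_range_add]
  rw [Finset.sum_eq_zero (s := Finset.range (n - i))]
  · simp
  · intro b hb
    simp [Finset.mem_range.mp hb]

/-- Two words that have only letters `2` off `p` and the same weight differ by a permutation
preserving `p`. -/
lemma exists_perm_of_wt_eq {ι : Type*} [Fintype ι] (p : ι → Prop) (a b : ι → Fin 2)
    (ha : ∀ x, ¬ p x → a x = 1) (hb : ∀ x, ¬ p x → b x = 1) (h : wt a = wt b) :
    ∃ π : Equiv.Perm ι, (∀ x, p (π x) ↔ p x) ∧ ∀ x, b (π x) = a x := by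
  have hcard : ∀ w : ι → Fin 2, (∀ x, ¬ p x → w x = 1) →
      (Finset.univ.filter fun x => p x ∧ w x = 1).card +
        (Finset.univ.filter fun x => ¬ p x).card = wt w ∧
      (Finset.univ.filter fun x => p x ∧ w x = 0).card +
        (Finset.univ.filter fun x => p x ∧ w x = 1).card =
        (Finset.univ.filter fun x => p x).card ∧
      (Finset.univ.filter fun x => ¬ p x ∧ w x = 1).card =
        (Finset.univ.filter fun x => ¬ p x).card ∧
      (Finset.univ.filter fun x => ¬ p x ∧ w x = 0).card = 0 := by
    intro w hw
    simp only [wt, Finset.card_filter, ← Finset.sum_add_distrib]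
    refine ⟨?_, ?_, ?_, Finset.sum_eq_zero fun x _ => ?_⟩
    any_goals refine Finset.sum_congr rfl fun x _ => ?_
    all_goals
      have h1 := hw x
      generalize w x = y at h1 ⊢
      by_cases hx : p x <;> fin_cases y <;> simp_all
  obtain ⟨a1, a2, a3, a4⟩ := hcard a ha
  obtain ⟨b1, b2, b3, b4⟩ := hcard b hb
  have key : ∀ c : Prop × Fin 2,
      Nonempty ({x // (p x, a x) = c} ≃ {x // (p x, b x) = c}) := by
    rintro ⟨q, y⟩
    rw [← Fintype.card_eq, Fintype.card_subtype, Fintype.card_subtype]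
    simp only [Prod.mk.injEq]
    by_cases hq : q
    · simp only [hq, eq_iff_iff, iff_true]
      fin_cases y
      · simp only [Fin.zero_eta]; omega
      · simp only [Fin.mk_one]; omega
    · simp only [hq, eq_iff_iff, iff_false]
      fin_cases y
      · simp only [Fin.zero_eta]; omega
      · simp only [Fin.mk_one]; omega
  have hπ := fun x => Equiv.ofFiberEquiv_map (f := fun x => (p x, a x))
    (g := fun x => (p x, b x)) (fun c => (key c).some) x
  refine ⟨Equiv.ofFiberEquiv (f := fun x => (p x, a x))
    (g := fun x => (p x, b x)) (fun c => (key c).some), fun x => ?_, fun x => ?_⟩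
  · exact iff_of_eq (congrArg Prod.fst (hπ x))
  · exact congrArg Prod.snd (hπ x)

lemma rowEquiv_tki_iff (n k i : ℕ) (hki : k ≤ i) (hi : i ≤ n - k)
    (w : Fin n → Fin 2) :
    (∃ π ∈ rowGroup n 2 ![n - k, k], w = fun b => tki n i (π⁻¹ b)) ↔
      (∀ b : Fin n, ¬ (b : ℕ) < n - k → w b = 1) ∧ wt w = i := by
  have ht : ∀ b : Fin n, ¬ (b : ℕ) < n - k → tki n i b = 1 := by
    intro b hb
    have : ¬ (b : ℕ) < n - i := by omega
    simp [tki, this]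
  have hwt := wt_tki n i (by omega)
  constructor
  · rintro ⟨π, hπ, rfl⟩
    rw [mem_rowGroup_iff] at hπ
    refine ⟨fun b hb => ht _ ?_, ?_⟩
    · rw [← hπ]
      simpa using hb
    · rw [wt_comp_equiv, hwt]
  · rintro ⟨h1, h2⟩
    obtain ⟨π, hp, hw⟩ := exists_perm_of_wt_eq (fun b : Fin n => (b : ℕ) < n - k) w (tki n i)
      h1 ht (h2.trans hwt.symm)
    refine ⟨π⁻¹, ?_, ?_⟩
    · rw [mem_rowGroup_iff]
      intro b
      rw [← hp]
      simp
    · funext b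
      simp [hw]

lemma eT_apply (n k i : ℕ) (hk : k ≤ n / 2) (hki : k ≤ i) (hi : i ≤ n - k)
    (a : Fin n → Fin 2) :
    eT n 2 ![n - k, k] (tki n i) a =
      ((if wt a = i then
        ∏ c : Fin k, (((a (boxEquiv n k hk (Sum.inl (c, 1))) : ℕ) : ℤ) -
          ((a (boxEquiv n k hk (Sum.inl (c, 0))) : ℕ) : ℤ)) else 0 : ℤ) : ℂ) := by
  have hinner : ∀ σ : Equiv.Perm (Fin n),
      (∑ t' ∈ Finset.univ.filter (fun t' : Fin n → Fin 2 =>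
        ∃ π ∈ rowGroup n 2 ![n - k, k], t' = fun b => tki n i (π⁻¹ b)),
        (Pi.single (fun b => t' (σ⁻¹ b)) (1 : ℂ) : (Fin n → Fin 2) → ℂ)) a =
      if (∀ b : Fin n, ¬ (b : ℕ) < n - k → a (σ b) = 1) ∧ wt a = i then 1 else 0 := by
    intro σ
    rw [Finset.sum_apply]
    have : ∀ t' : Fin n → Fin 2,
        (Pi.single (fun b => t' (σ⁻¹ b)) (1 : ℂ) : (Fin n → Fin 2) → ℂ) a =
          if t' = fun b => a (σ b) then 1 else 0 := by
      intro t'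
      rw [Pi.single_apply]
      refine if_congr ⟨?_, ?_⟩ rfl rfl
      · rintro rfl
        funext b
        simp
      · rintro rfl
        funext b
        simp
    simp only [this]
    rw [Finset.sum_ite_eq']
    simp only [Finset.mem_filter, Finset.mem_univ, true_and,
      rowEquiv_tki_iff n k i hki hi, wt_comp_equiv]
  have hbot : ∀ f : Fin k → Equiv.Perm (Fin 2),
      (∀ b : Fin n, ¬ (b : ℕ) < n - k → a (colPerm n k hk f b) = 1) ↔
        ∀ c, a (boxEquiv n k hk (Sum.inl (c, f c 1))) = 1 := by
    intro f
    constructor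
    · intro h c
      rw [← colPerm_inl]
      apply h
      rw [boxEquiv_inl_one]
      omega
    · intro h b hb
      obtain ⟨⟨c, x⟩ | m, rfl⟩ := (boxEquiv n k hk).surjective b
      · rw [colPerm_inl]
        fin_cases x
        · exact absurd (by simp only [Fin.zero_eta, boxEquiv_inl_zero]; have := c.2; omega) hb
        · exact h c
      · exact absurd (by rw [boxEquiv_inr]; have := m.2; omega) hb
  unfold eT
  rw [colGroup_eq_image n k hk, Finset.sum_image (colPerm_injective n k hk).injOn,
    Finset.sum_apply]
  simp only [Pi.smul_apply, smul_eq_mul, hinner, sign_colPerm, hbot]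
  by_cases hw : wt a = i
  · simp only [hw, and_true, if_true]
    have hcol : ∀ c : Fin k, (((a (boxEquiv n k hk (Sum.inl (c, 1))) : ℕ) : ℤ) -
          ((a (boxEquiv n k hk (Sum.inl (c, 0))) : ℕ) : ℤ)) =
        ∑ g : Equiv.Perm (Fin 2), (Equiv.Perm.sign g : ℤ) *
          if a (boxEquiv n k hk (Sum.inl (c, g 1))) = 1 then 1 else 0 := by
      intro c
      have hu : (Finset.univ : Finset (Equiv.Perm (Fin 2))) = {1, Equiv.swap 0 1} := by decide
      have hne : (1 : Equiv.Perm (Fin 2)) ≠ Equiv.swap 0 1 := by decide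
      have hs : Equiv.Perm.sign (Equiv.swap (0 : Fin 2) 1) = -1 := by decide
      rw [hu, Finset.sum_pair hne, hs]
      simp only [Equiv.Perm.sign_one, Equiv.Perm.one_apply, Equiv.swap_apply_right]
      have hlet : ∀ y z : Fin 2, ((y : ℕ) : ℤ) - ((z : ℕ) : ℤ) =
          ((1 : ℤˣ) : ℤ) * (if y = 1 then 1 else 0) +
            ((-1 : ℤˣ) : ℤ) * (if z = 1 then 1 else 0) := by decide
      rw [hlet]
      congr
    simp only [hcol]
    rw [Finset.prod_univ_sum, Fintype.piFinset_univ]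
    push_cast
    refine Finset.sum_congr rfl fun f _ => ?_
    rw [Finset.prod_mul_distrib, Finset.prod_boole]
    simp
  · simp [hw]

lemma Dmat_eq_Dtij_iff (n i j t : ℕ) (hti : t ≤ i) (htj : t ≤ j) (hijt : i + j - t ≤ n)
    (a b : Fin n → Fin 2) :
    Dmat a b = Dtij n i j t ↔ wt a = j ∧ wt b = i ∧ overlap a b = t := by
  have h11 : Dmat a b 1 1 = overlap a b := by
    simp only [Dmat, Matrix.of_apply, overlap, Finset.card_filter]
    refine Finset.sum_congr rfl fun x _ => ?_
    generalize a x = y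
    generalize b x = z
    fin_cases y <;> fin_cases z <;> simp
  have h10 : Dmat a b 1 0 + Dmat a b 1 1 = wt a := by
    simp only [Dmat, Matrix.of_apply, wt, Finset.card_filter, ← Finset.sum_add_distrib]
    refine Finset.sum_congr rfl fun x _ => ?_
    generalize a x = y
    generalize b x = z
    fin_cases y <;> fin_cases z <;> simp
  have h01 : Dmat a b 0 1 + Dmat a b 1 1 = wt b := by
    simp only [Dmat, Matrix.of_apply, wt, Finset.card_filter, ← Finset.sum_add_distrib]
    refine Finset.sum_congr rfl fun x _ => ?_
    generalize a x = y
    generalize b x = z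
    fin_cases y <;> fin_cases z <;> simp
  have h00 : Dmat a b 0 0 + Dmat a b 0 1 + Dmat a b 1 0 + Dmat a b 1 1 = n := by
    conv_rhs => rw [← Fintype.card_fin n, ← Finset.card_univ, Finset.card_eq_sum_ones]
    simp only [Dmat, Matrix.of_apply, Finset.card_filter, ← Finset.sum_add_distrib]
    refine Finset.sum_congr rfl fun x _ => ?_
    generalize a x = y
    generalize b x = z
    fin_cases y <;> fin_cases z <;> simp
  rw [← Matrix.ext_iff]
  simp only [Fin.forall_fin_two, Dtij, Matrix.of_apply, Matrix.cons_val_zero,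
    Matrix.cons_val_one]
  omega

/-- Words on the boxes of `(n - k, k)` split into letters on the columns of height two and
on the columns of height one. -/
def wordEquiv (n k : ℕ) (hk : k ≤ n / 2) :
    (Fin k → Fin 2 × Fin 2) × (Fin (n - 2 * k) → Fin 2) ≃ (Fin n → Fin 2) where
  toFun u b := Sum.elim (fun cx => if cx.2 = 0 then (u.1 cx.1).1 else (u.1 cx.1).2) u.2
    ((boxEquiv n k hk).symm b)
  invFun a := (fun c => (a (boxEquiv n k hk (Sum.inl (c, 0))),
    a (boxEquiv n k hk (Sum.inl (c, 1)))), fun m => a (boxEquiv n k hk (Sum.inr m)))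
  left_inv u := by simp
  right_inv a := by
    funext b
    obtain ⟨⟨c, x⟩ | m, rfl⟩ := (boxEquiv n k hk).surjective b
    · fin_cases x <;> simp
    · simp

lemma wt_wordEquiv (n k : ℕ) (hk : k ≤ n / 2)
    (u : (Fin k → Fin 2 × Fin 2) × (Fin (n - 2 * k) → Fin 2)) :
    wt (wordEquiv n k hk u) = ∑ c, (((u.1 c).1 : ℕ) + (u.1 c).2) + wt u.2 := by
  unfold wt
  rw [← Equiv.sum_comp (boxEquiv n k hk), Fintype.sum_sum_type, Fintype.sum_prod_type]
  simp [wordEquiv, Fin.sum_univ_two]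

lemma overlap_wordEquiv (n k : ℕ) (hk : k ≤ n / 2)
    (u v : (Fin k → Fin 2 × Fin 2) × (Fin (n - 2 * k) → Fin 2)) :
    overlap (wordEquiv n k hk u) (wordEquiv n k hk v) =
      ∑ c, (((u.1 c).1 : ℕ) * (v.1 c).1 + (u.1 c).2 * (v.1 c).2) + overlap u.2 v.2 := by
  unfold overlap
  rw [← Equiv.sum_comp (boxEquiv n k hk), Fintype.sum_sum_type, Fintype.sum_prod_type]
  simp [wordEquiv, Fin.sum_univ_two]

lemma sum_columns (k : ℕ) (G : ℕ → ℕ → ℕ → ℤ) :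
    ∑ u : Fin k → Fin 2 × Fin 2, ∑ v : Fin k → Fin 2 × Fin 2,
      (∏ c, (((u c).2 : ℕ) - ((u c).1 : ℕ) : ℤ)) * (∏ c, (((v c).2 : ℕ) - ((v c).1 : ℕ) : ℤ)) *
        G (∑ c, (((u c).1 : ℕ) + (u c).2)) (∑ c, (((v c).1 : ℕ) + (v c).2))
          (∑ c, (((u c).1 : ℕ) * (v c).1 + (u c).2 * (v c).2)) =
      2 ^ k * ∑ m ∈ Finset.range (k + 1), (-1) ^ (k - m) * (k.choose m : ℤ) * G k k m := by
  suffices h : ∀ G : ℕ → ℕ → ℕ → ℤ, ∑ u : Fin k → Fin 2 × Fin 2, ∑ v : Fin k → Fin 2 × Fin 2,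
      (∏ c, (((u c).2 : ℕ) - ((u c).1 : ℕ) : ℤ)) * (∏ c, (((v c).2 : ℕ) - ((v c).1 : ℕ) : ℤ)) *
        G (∑ c, (((u c).1 : ℕ) + (u c).2)) (∑ c, (((v c).1 : ℕ) + (v c).2))
          (∑ c, (((u c).1 : ℕ) * (v c).1 + (u c).2 * (v c).2)) =
      2 ^ k * (fwdDiff 1)^[k] (fun m => G k k m) 0 by
    rw [h, fwdDiff_iter_eq_sum_shift]
    simp
  clear G
  induction k with
  | zero => intro G; simp
  | succ k ih =>
    intro G
    have hsum : ∀ F : (Fin (k + 1) → Fin 2 × Fin 2) → ℤ,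
        ∑ u, F u = ∑ x : Fin 2 × Fin 2, ∑ u : Fin k → Fin 2 × Fin 2, F (Fin.cons x u) := by
      intro F
      rw [← Equiv.sum_comp (Fin.consEquiv fun _ => Fin 2 × Fin 2), Fintype.sum_prod_type]
      rfl
    rw [hsum]
    simp only [hsum, Fin.prod_univ_succ, Fin.sum_univ_succ, Fin.cons_zero, Fin.cons_succ]
    have h1 := ih fun p q r => G (1 + p) (1 + q) (1 + r)
    have h0 := ih fun p q r => G (1 + p) (1 + q) r
    have hstep : (fwdDiff 1)^[k + 1] (fun m => G (k + 1) (k + 1) m) 0 =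
        (fwdDiff 1)^[k] (fun m => G (1 + k) (1 + k) (1 + m)) 0 -
          (fwdDiff 1)^[k] (fun m => G (1 + k) (1 + k) m) 0 := by
      rw [Function.iterate_succ_apply', fwdDiff]
      congr 1
      · rw [fwdDiff_iter_eq_sum_shift, fwdDiff_iter_eq_sum_shift]
        simp [add_comm]
      · simp [add_comm]
    rw [hstep, pow_succ, mul_sub, mul_comm ((2 : ℤ) ^ k) 2, mul_assoc, mul_assoc, ← h1, ← h0]
    simp only [Fintype.sum_prod_type, Fin.sum_univ_two]
    simp [Finset.sum_add_distrib, Finset.mul_sum]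
    ring_nf
    simp only [Finset.sum_mul]

lemma card_filter_card_inter {ι : Type*} [Fintype ι] [DecidableEq ι] (T : Finset ι)
    (q r : ℕ) (hr : r ≤ q) :
    (Finset.univ.filter fun S : Finset ι => S.card = q ∧ (S ∩ T).card = r).card =
      T.card.choose r * (Fintype.card ι - T.card).choose (q - r) := by
  rw [← Finset.card_compl, ← Finset.card_powersetCard, ← Finset.card_powersetCard,
    ← Finset.card_product]
  refine Finset.card_nbij' (fun S => (S ∩ T, S \ T)) (fun P => P.1 ∪ P.2) ?_ ?_ ?_ ?_
  · intro S hS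
    simp only [Finset.coe_filter, Finset.mem_univ, true_and, Set.mem_ofPred_eq] at hS
    have := Finset.card_inter_add_card_sdiff S T
    simp only [Finset.coe_product, Set.mem_prod, Finset.mem_coe, Finset.mem_powersetCard]
    refine ⟨⟨Finset.inter_subset_right, hS.2⟩, ?_, by omega⟩
    intro x hx
    simp_all
  · rintro ⟨A, B⟩ h
    simp only [Finset.coe_product, Set.mem_prod, Finset.mem_coe, Finset.mem_powersetCard] at h
    obtain ⟨⟨hA, hA'⟩, hB, hB'⟩ := h
    have hd : Disjoint A B := Finset.disjoint_left.mpr fun x hx hx' =>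
      (Finset.mem_compl.mp (hB hx')) (hA hx)
    have hi : (A ∪ B) ∩ T = A := by
      ext x
      have h1 := @hA x
      have h2 := @hB x
      simp only [Finset.mem_compl, Finset.mem_inter, Finset.mem_union] at *
      tauto
    simp only [Finset.coe_filter, Finset.mem_univ, true_and, Set.mem_ofPred_eq, hi,
      Finset.card_union_of_disjoint hd]
    omega
  · intro S _
    ext x
    simp only [Finset.mem_union, Finset.mem_inter, Finset.mem_sdiff]
    tauto
  · rintro ⟨A, B⟩ h
    simp only [Finset.coe_product, Set.mem_prod, Finset.mem_coe, Finset.mem_powersetCard] at h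
    obtain ⟨⟨hA, hA'⟩, hB, hB'⟩ := h
    refine Prod.ext ?_ ?_
    all_goals
      ext x
      have h1 := @hA x
      have h2 := @hB x
      simp only [Finset.mem_compl, Finset.mem_inter, Finset.mem_union, Finset.mem_sdiff] at *
      tauto

/-- The words in two letters, as subsets of the index set. -/
def supportEquiv (ι : Type*) [Fintype ι] : Finset ι ≃ (ι → Fin 2) where
  toFun S x := if x ∈ S then 1 else 0
  invFun a := Finset.univ.filter fun x => a x = 1
  left_inv S := by ext x; simp
  right_inv a := by
    funext x
    have : ∀ y : Fin 2, (if y = 1 then (1 : Fin 2) else 0) = y := by decide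
    simp [this]

lemma wt_supportEquiv {ι : Type*} [Fintype ι] (S : Finset ι) :
    wt (supportEquiv ι S) = S.card := by
  rw [wt_eq_card]
  congr 1
  ext x
  simp [supportEquiv]

lemma overlap_supportEquiv {ι : Type*} [Fintype ι] [DecidableEq ι] (S T : Finset ι) :
    overlap (supportEquiv ι S) (supportEquiv ι T) = (S ∩ T).card := by
  have h : ∀ x, ((supportEquiv ι S x : ℕ) * (supportEquiv ι T x : ℕ)) =
      if x ∈ S ∩ T then 1 else 0 := by
    intro x
    by_cases h1 : x ∈ S <;> by_cases h2 : x ∈ T <;> simp [supportEquiv, h1, h2]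
  simp only [overlap, h]
  rw [← Finset.card_filter]
  congr 1
  ext x
  simp

lemma sum_words_overlap (N p q r : ℕ) (hr : r ≤ q) :
    ∑ a : Fin N → Fin 2, ∑ b : Fin N → Fin 2,
      (if wt a = q ∧ wt b = p ∧ overlap a b = r then 1 else 0 : ℤ) =
      (N.choose p * (p.choose r * (N - p).choose (q - r)) : ℕ) := by
  rw [Finset.sum_comm, ← Equiv.sum_comp (supportEquiv (Fin N)),
    Finset.sum_congr rfl fun b _ => (Equiv.sum_comp (supportEquiv (Fin N)) _).symm]
  simp only [wt_supportEquiv, overlap_supportEquiv]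
  have h : ∀ T : Finset (Fin N), ∑ S : Finset (Fin N),
      (if S.card = q ∧ T.card = p ∧ (S ∩ T).card = r then 1 else 0 : ℤ) =
      if T.card = p then ((p.choose r * (N - p).choose (q - r) : ℕ) : ℤ) else 0 := by
    intro T
    by_cases hT : T.card = p
    · have := card_filter_card_inter T q r hr
      rw [hT, Fintype.card_fin] at this
      rw [← this, if_pos hT, Finset.card_filter]
      push_cast
      exact Finset.sum_congr rfl fun S _ => if_congr (by simp [hT]) rfl rfl
    · simp [hT]
  simp only [h]
  rw [← Finset.sum_filter, Finset.sum_const, ← Finset.powerset_univ,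
    ← Finset.powersetCard_eq_filter, Finset.card_powersetCard, Finset.card_univ,
    Fintype.card_fin]
  simp

lemma sum_ite_mul_intCast {α : Type*} [Fintype α] (C : α → Prop) [DecidablePred C]
    (x : α → ℤ) (y : ℤ) :
    (∑ b, (if C b then (1 : ℂ) else 0) * (x b : ℂ)) * (y : ℂ) =
      ((∑ b, if C b then x b * y else 0 : ℤ) : ℂ) := by
  rw [Finset.sum_mul, Int.cast_sum]
  refine Finset.sum_congr rfl fun b _ => ?_
  split_ifs <;> simp

lemma sinner_AD_eT (n k i j t i' j' : ℕ) (hk : k ≤ n / 2)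
    (hki' : k ≤ i') (hi'n : i' ≤ n - k) (hkj' : k ≤ j') (hj'n : j' ≤ n - k)
    (hti : t ≤ i) (htj : t ≤ j) (hijt : i + j - t ≤ n) :
    sinner ((AD n 2 (Dtij n i j t)).mulVec (eT n 2 ![n - k, k] (tki n i')))
        (eT n 2 ![n - k, k] (tki n j')) =
      ((if i = i' ∧ j = j' then
        2 ^ k * ∑ m ∈ Finset.range (k + 1), (-1) ^ (k - m) * (k.choose m : ℤ) *
          ∑ a : Fin (n - 2 * k) → Fin 2, ∑ b : Fin (n - 2 * k) → Fin 2,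
            (if k + wt a = j ∧ k + wt b = i ∧ m + overlap a b = t then 1 else 0)
      else 0 : ℤ) : ℂ) := by
  have hcol := sum_columns k fun p q r =>
    ∑ a : Fin (n - 2 * k) → Fin 2, ∑ b : Fin (n - 2 * k) → Fin 2,
      (if p + wt a = j ∧ q + wt b = i ∧ r + overlap a b = t then 1 else 0)
  rw [← hcol]
  simp only [sinner, Matrix.mulVec, dotProduct, AD, Matrix.of_apply,
    eT_apply n k _ hk hki' hi'n, eT_apply n k _ hk hkj' hj'n,
    Dmat_eq_Dtij_iff n i j t hti htj hijt, map_intCast]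
  simp only [sum_ite_mul_intCast]
  rw [← Int.cast_sum]
  congr 1
  by_cases h : i = i' ∧ j = j'
  · obtain ⟨rfl, rfl⟩ := h
    simp only [and_self, if_true]
    have hsplit : ∀ F : (Fin n → Fin 2) → (Fin n → Fin 2) → ℤ, ∑ a, ∑ b, F a b =
        ∑ u, ∑ v, ∑ r, ∑ s, F (wordEquiv n k hk (u, r)) (wordEquiv n k hk (v, s)) := by
      intro F
      rw [← Equiv.sum_comp (wordEquiv n k hk), Fintype.sum_prod_type]
      refine Finset.sum_congr rfl fun u _ => ?_
      symm
      rw [Finset.sum_comm]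
      refine Finset.sum_congr rfl fun r _ => ?_
      rw [← Equiv.sum_comp (wordEquiv n k hk), Fintype.sum_prod_type]
    rw [hsplit]
    refine Finset.sum_congr rfl fun u _ => Finset.sum_congr rfl fun v _ => ?_
    rw [Finset.mul_sum]
    refine Finset.sum_congr rfl fun r _ => ?_
    rw [Finset.mul_sum]
    refine Finset.sum_congr rfl fun s _ => ?_
    have hP : ∀ (w : Fin k → Fin 2 × Fin 2) (q : Fin (n - 2 * k) → Fin 2),
        ∏ c, (((wordEquiv n k hk (w, q) (boxEquiv n k hk (Sum.inl (c, 1))) : ℕ) : ℤ) -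
          ((wordEquiv n k hk (w, q) (boxEquiv n k hk (Sum.inl (c, 0))) : ℕ) : ℤ)) =
        ∏ c, (((w c).2 : ℕ) - ((w c).1 : ℕ) : ℤ) := by
      intro w q
      simp [wordEquiv]
    rw [hP, hP, wt_wordEquiv, wt_wordEquiv, overlap_wordEquiv]
    conv_rhs => rw [mul_ite, mul_one, mul_zero]
    refine ite_congr rfl (fun hc => ?_) fun _ => rfl
    rw [if_pos hc.2.1, if_pos hc.1, mul_comm]
  · rw [if_neg h]
    refine Finset.sum_eq_zero fun a _ => Finset.sum_eq_zero fun b _ => ?_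
    refine ite_eq_right_iff.mpr fun hc => ?_
    rw [mul_eq_zero, ite_eq_right_iff, ite_eq_right_iff]
    by_cases hi : i = i'
    · exact Or.inr fun hj => absurd ⟨hi, hc.1.symm.trans hj⟩ h
    · exact Or.inl fun hi' => absurd (hc.2.1.symm.trans hi') hi

lemma overlap_le_wt {ι : Type*} [Fintype ι] (a b : ι → Fin 2) : overlap a b ≤ wt a :=
  Finset.sum_le_sum fun x _ => by
    have := (b x).2
    exact mul_le_of_le_one_right (Nat.zero_le _) (by omega)

lemma sum_words_shifted (N k i j t m : ℕ) (hki : k ≤ i) (hkj : k ≤ j) :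
    ∑ a : Fin N → Fin 2, ∑ b : Fin N → Fin 2,
      (if k + wt a = j ∧ k + wt b = i ∧ m + overlap a b = t then 1 else 0 : ℤ) =
      if m ≤ t ∧ t ≤ m + (j - k) then
        ((N.choose (i - k) * ((i - k).choose (t - m) *
          (N - (i - k)).choose (j - k - (t - m))) : ℕ) : ℤ) else 0 := by
  split_ifs with h
  · rw [← sum_words_overlap N (i - k) (j - k) (t - m) (by omega)]
    refine Finset.sum_congr rfl fun a _ => Finset.sum_congr rfl fun b _ => ?_
    exact if_congr (by omega) rfl rfl
  · refine Finset.sum_eq_zero fun a _ => Finset.sum_eq_zero fun b _ => ?_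
    have := overlap_le_wt a b
    exact if_neg (by omega)

lemma zchoose_natCast (a b : ℕ) : zchoose a b = (a.choose b : ℤ) := by
  unfold zchoose
  split_ifs with h
  · simp
  · rw [Nat.choose_eq_zero_of_lt (by omega), Nat.cast_zero]

lemma isign_natCast (a : ℕ) : isign a = (-1) ^ a := by
  unfold isign
  split_ifs with h
  · exact (Even.neg_one_pow (by rw [Nat.even_iff]; omega)).symm
  · exact (Odd.neg_one_pow (by rw [Nat.odd_iff]; omega)).symm

lemma sum_reindex (n k i j t : ℕ) (hk : k ≤ n / 2) (hki : k ≤ i) (hin : i ≤ n - k)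
    (hkj : k ≤ j) (htj : t ≤ j) :
    ∑ m ∈ Finset.range (k + 1), (-1) ^ (k - m) * (k.choose m : ℤ) *
      (if m ≤ t ∧ t ≤ m + (j - k) then
        (((n - 2 * k).choose (i - k) * ((i - k).choose (t - m) *
          (n - 2 * k - (i - k)).choose (j - k - (t - m))) : ℕ) : ℤ) else 0) =
    ((n - 2 * k).choose (i - k) : ℤ) * ∑ s ∈ Finset.range (j - k + 1),
      isign ((j : ℤ) - t - s) * zchoose ((n : ℤ) - k - i) (s : ℤ) *
        zchoose ((i : ℤ) - k) ((j : ℤ) - k - s) * zchoose (k : ℤ) ((j : ℤ) - t - s) := by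
  have hr : ∑ s ∈ Finset.range (j - k + 1),
      isign ((j : ℤ) - t - s) * zchoose ((n : ℤ) - k - i) (s : ℤ) *
        zchoose ((i : ℤ) - k) ((j : ℤ) - k - s) * zchoose (k : ℤ) ((j : ℤ) - t - s) =
      ∑ s ∈ Finset.range (j - k + 1), if t + s ≤ j ∧ j ≤ t + s + k then
        (-1) ^ (j - t - s) * ((n - k - i).choose s : ℤ) * ((i - k).choose (j - k - s) : ℤ) *
          (k.choose (j - t - s) : ℤ) else 0 := by
    refine Finset.sum_congr rfl fun s hs => ?_
    rw [Finset.mem_range] at hs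
    split_ifs with h
    · rw [← zchoose_natCast, ← zchoose_natCast, ← zchoose_natCast, ← isign_natCast]
      congr <;> omega
    · have : zchoose (k : ℤ) ((j : ℤ) - t - s) = 0 := if_neg (by omega)
      rw [this, mul_zero]
  rw [hr, Finset.mul_sum]
  simp only [mul_ite, mul_zero]
  rw [← Finset.sum_filter, ← Finset.sum_filter]
  refine Finset.sum_nbij' (fun m => m + (j - k) - t) (fun s => s + t + k - j) ?_ ?_ ?_ ?_ ?_
  · intro m hm
    simp only [Finset.mem_filter, Finset.mem_range] at hm ⊢
    omega
  · intro m hm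
    simp only [Finset.mem_filter, Finset.mem_range] at hm ⊢
    omega
  · intro m hm
    simp only [Finset.mem_filter, Finset.mem_range] at hm
    omega
  · intro m hm
    simp only [Finset.mem_filter, Finset.mem_range] at hm
    omega
  · intro m hm
    simp only [Finset.mem_filter, Finset.mem_range] at hm
    have e1 : j - t - (m + (j - k) - t) = k - m := by omega
    have e2 : j - k - (m + (j - k) - t) = t - m := by omega
    have e3 : n - 2 * k - (i - k) = n - k - i := by omega
    have e4 : j - k - (t - m) = m + (j - k) - t := by omega
    rw [e1, e2, e3, e4, Nat.choose_symm (by omega : m ≤ k)]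
    push_cast
    ring

/-- for `λ = (n-k,k)` and `D = D^t_{i,j}`,
`⟨A_D e_{t_{k,i'}}, e_{t_{k,j'}}⟩ = δ_{i,i'} δ_{j,j'} 2^k C(n-2k, i-k)
Σ_{s=0}^{j-k} (-1)^{j-t-s} C(n-k-i, s) C(i-k, j-k-s) C(k, j-t-s)`. -/
theorem stmt_14 (n k i j t i' j' : ℕ) (hn : 1 ≤ n) (hk : k ≤ n / 2)
    (hki' : k ≤ i') (hi'n : i' ≤ n - k) (hkj' : k ≤ j') (hj'n : j' ≤ n - k)
    (hti : t ≤ i) (htj : t ≤ j) (hijt : i + j - t ≤ n) :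
    sinner ((AD n 2 (Dtij n i j t)).mulVec (eT n 2 ![n - k, k] (tki n i')))
        (eT n 2 ![n - k, k] (tki n j')) =
      if i = i' ∧ j = j' then
        ((2 ^ k * (n - 2 * k).choose (i - k) : ℕ) : ℂ) *
          ((∑ s ∈ Finset.range (j - k + 1),
            isign ((j : ℤ) - t - s) * zchoose ((n : ℤ) - k - i) (s : ℤ) *
              zchoose ((i : ℤ) - k) ((j : ℤ) - k - s) *
              zchoose (k : ℤ) ((j : ℤ) - t - s) : ℤ) : ℂ)
      else 0 := by
  rw [sinner_AD_eT n k i j t i' j' hk hki' hi'n hkj' hj'n hti htj hijt]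
  split_ifs with h
  · obtain ⟨rfl, rfl⟩ := h
    simp only [sum_words_shifted _ k i j t _ hki' hkj']
    rw [sum_reindex n k i j t hk hki' hi'n hkj' htj]
    push_cast
    ring
  · simp
end
end
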